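/- arXiv:2308.06427 — 3 statements merged into one kernel-verified Lean document; each statement's English description precedes it below -/
import Mathlib

section
/- Let M = {(ξ, Σ_i a_iξ_i², Σ_i b_iξ_i²) : ξ ∈ [0,1]^d} be a good manifold and write Q = (P, Q') with P(ξ) = Σ_i a_iξ_i² and Q'(ξ) = Σ_i b_iξ_i². Then for every 0 ≤ m ≤ d: 𝔡_{d−m,2}(Q) ≥ d−m and 𝔡_{d−m,1}(Q) ≥ d−2m−1. -/
open Classical

noncomputable section

/-- `NV(Q)`: the number of variables `ξ_i` on which the tuple `Q = (Q₁,…,Q_n)` of (quadratic)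
forms genuinely depends, i.e. the number of indices `i` such that `∂_{ξ_i} Q_l` is not
identically zero for some `l`. -/
def numVars (d n : ℕ) (Q : Fin n → (Fin d → ℝ) → ℝ) : ℕ :=
  Set.ncard {i : Fin d | ∃ (l : Fin n) (ξ : Fin d → ℝ),
    fderiv ℝ (Q l) ξ (Pi.single i 1) ≠ 0}

/-- `𝔡_{d',n'}(Q)`: the infimum of `NV(M'·(Q∘M))` over matrices `M ∈ ℝ^{d×d}` of rank `d'`
and `M' ∈ ℝ^{n×n}` of rank `n'`. -/
def frakd (d n : ℕ) (Q : Fin n → (Fin d → ℝ) → ℝ) (d' n' : ℕ) : ℕ :=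
  sInf {r : ℕ | ∃ (M : Matrix (Fin d) (Fin d) ℝ) (M' : Matrix (Fin n) (Fin n) ℝ),
    M.rank = d' ∧ M'.rank = n' ∧
    r = numVars d n (fun l ξ => ∑ j, M' l j * Q j (M.mulVec ξ))}

/-- The data `(a,b)` define a good manifold: all `a_i > 0` and every `2×2` minor of the
matrix with rows `a`, `b` has nonzero determinant. -/
def IsGoodManifold (d : ℕ) (a b : Fin d → ℝ) : Prop :=
  (∀ i, 0 < a i) ∧ ∀ i j : Fin d, i ≠ j → a i * b j - a j * b i ≠ 0

/-- **Sylvester's rank inequality.** -/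
theorem Matrix.rank_add_rank_le_rank_mul_add_card {K l m n : Type*} [Field K] [Fintype l]
    [Fintype m] [Fintype n] (A : Matrix l m K) (B : Matrix m n K) :
    A.rank + B.rank ≤ (A * B).rank + Fintype.card m := by
  have hA := LinearMap.finrank_range_add_finrank_ker A.mulVecLin
  have hAB := LinearMap.finrank_range_add_finrank_ker
    (A.mulVecLin.domRestrict B.mulVecLin.range)
  have hker : Module.finrank K (A.mulVecLin.domRestrict B.mulVecLin.range).ker ≤
      Module.finrank K A.mulVecLin.ker := by
    refine LinearMap.finrank_le_finrank_of_injective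
      (f := B.mulVecLin.range.subtype.restrict (p := LinearMap.ker _) (q := A.mulVecLin.ker)
        fun x hx => hx) fun x y h => ?_
    have hval := congrArg Subtype.val h
    exact Subtype.ext (Subtype.ext hval)
  have hrange : (A.mulVecLin.domRestrict B.mulVecLin.range).range = (A * B).mulVecLin.range := by
    rw [LinearMap.range_domRestrict, Matrix.mulVecLin_mul, LinearMap.range_comp]
  rw [hrange] at hAB
  rw [Module.finrank_fintype_fun_eq_card] at hA
  simp only [Matrix.rank]
  omega

/-- The rank of a square matrix is at most the number of its nonzero columns. -/
theorem Matrix.rank_le_ncard_of_col_eq_zero {K n : Type*} [Field K] [Fintype n]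
    (A : Matrix n n K) (S : Set n) (hS : ∀ i ∉ S, ∀ j, A j i = 0) : A.rank ≤ S.ncard := by
  rw [← Matrix.rank_transpose, Set.ncard_eq_toFinset_card']
  refine Matrix.rank_le_card_of_support_subset _ _ (Function.support_subset_iff'.2 fun i hi => ?_)
  exact funext (hS i (by simpa using hi))

/-- A partial derivative of the diagonal form with coefficients `c` pulled back along `M` is
given by the Gram matrix `Mᵀ * diagonal c * M`. -/
theorem fderiv_sum_mul_mulVec_sq {d : ℕ} (c : Fin d → ℝ) (M : Matrix (Fin d) (Fin d) ℝ)
    (ξ v : Fin d → ℝ) :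
    fderiv ℝ (fun ξ => ∑ k, c k * (M.mulVec ξ) k ^ 2) ξ v =
      2 * ∑ k, c k * (M.mulVec ξ) k * (M.mulVec v) k := by
  have hlin (k : Fin d) : HasFDerivAt (fun ξ : Fin d → ℝ => (M.mulVec ξ) k)
      ((LinearMap.proj k).comp M.mulVecLin).toContinuousLinearMap ξ :=
    ((LinearMap.proj k).comp M.mulVecLin).toContinuousLinearMap.hasFDerivAt
  have h := HasFDerivAt.fun_sum (u := Finset.univ)
    fun k _ => ((hlin k).pow 2).const_mul (c k)
  rw [h.fderiv, sum_apply, Finset.mul_sum]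
  refine Finset.sum_congr rfl fun k _ => ?_
  simp
  ring

/-- If the partial derivatives in direction `i` of a pulled back diagonal form all vanish, then
so does the corresponding column of the Gram matrix. -/
theorem sum_mul_eq_zero_of_fderiv_eq_zero {d : ℕ} {c : Fin d → ℝ}
    {M : Matrix (Fin d) (Fin d) ℝ} {i : Fin d}
    (h : ∀ ξ, fderiv ℝ (fun ξ => ∑ k, c k * (M.mulVec ξ) k ^ 2) ξ (Pi.single i 1) = 0)
    (j : Fin d) : ∑ k, c k * M k j * M k i = 0 := by
  have := h (Pi.single j 1)
  rw [fderiv_sum_mul_mulVec_sq] at this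
  simpa using this

/-- The matrices of rank `r ≤ n` exist. -/
theorem Matrix.exists_rank_eq (K : Type*) [Field K] {n r : ℕ} (hr : r ≤ n) :
    ∃ M : Matrix (Fin n) (Fin n) K, M.rank = r := by
  refine ⟨Matrix.diagonal fun i => if (i : ℕ) < r then 1 else 0, ?_⟩
  rw [Matrix.rank_diagonal]
  simp only [ne_eq, ite_eq_right_iff, one_ne_zero, imp_false, not_not, Fintype.card_subtype]
  simp [Fin.card_filter_val_lt, hr]

/-- A lower bound for `NV` over all admissible pairs of matrices bounds `𝔡` from below. -/
theorem le_frakd {d n : ℕ} {Q : Fin n → (Fin d → ℝ) → ℝ} {d' n' r : ℕ} (hd : d' ≤ d)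
    (hn : n' ≤ n)
    (h : ∀ (M : Matrix (Fin d) (Fin d) ℝ) (M' : Matrix (Fin n) (Fin n) ℝ), M.rank = d' →
      M'.rank = n' → r ≤ numVars d n (fun l ξ => ∑ j, M' l j * Q j (M.mulVec ξ))) :
    r ≤ frakd d n Q d' n' := by
  obtain ⟨M, hM⟩ := Matrix.exists_rank_eq ℝ hd
  obtain ⟨M', hM'⟩ := Matrix.exists_rank_eq ℝ hn
  refine le_csInf ⟨_, M, M', hM, hM', rfl⟩ ?_
  rintro _ ⟨M, N, hM, hN, rfl⟩
  exact h M N hM hN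

/-- A linear combination of two pulled back diagonal forms is a pulled back diagonal form. -/
theorem sum_mul_diagonal_forms {d : ℕ} (a b : Fin d → ℝ) (M : Matrix (Fin d) (Fin d) ℝ)
    (M' : Matrix (Fin 2) (Fin 2) ℝ) (l : Fin 2) :
    (fun ξ => ∑ j, M' l j * (fun (l : Fin 2) (ξ : Fin d → ℝ) =>
      if l = 0 then ∑ i, a i * ξ i ^ 2 else ∑ i, b i * ξ i ^ 2) j (M.mulVec ξ)) =
    fun ξ => ∑ k, (M' l 0 * a k + M' l 1 * b k) * (M.mulVec ξ) k ^ 2 := by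
  funext ξ
  simp [Fin.sum_univ_two, Finset.mul_sum, add_mul, Finset.sum_add_distrib, mul_assoc]

theorem rank_le_numVars_of_rank_eq_two {d : ℕ} {a : Fin d → ℝ} (b : Fin d → ℝ)
    (ha : ∀ i, 0 < a i) (M : Matrix (Fin d) (Fin d) ℝ) {M' : Matrix (Fin 2) (Fin 2) ℝ}
    (hM' : M'.rank = 2) :
    M.rank ≤ numVars d 2 (fun l ξ => ∑ j, M' l j * (fun (l : Fin 2) (ξ : Fin d → ℝ) =>
      if l = 0 then ∑ i, a i * ξ i ^ 2 else ∑ i, b i * ξ i ^ 2) j (M.mulVec ξ)) := by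
  refine Matrix.rank_le_ncard_of_col_eq_zero M _ fun i hi => ?_
  simp only [sum_mul_diagonal_forms, Set.mem_ofPred_eq, not_exists, not_not] at hi
  have hinj : Function.Injective M'.mulVecLin := by
    rw [LinearMap.injective_iff_surjective, ← LinearMap.range_eq_top]
    exact Submodule.eq_top_of_finrank_eq (by simpa [Matrix.rank] using hM')
  have hzero : M'.mulVecLin ![∑ k, a k * M k i * M k i, ∑ k, b k * M k i * M k i] = 0 := by
    funext l
    have := sum_mul_eq_zero_of_fderiv_eq_zero (hi l) i
    simpa [Matrix.mulVec, dotProduct, Fin.sum_univ_two, Finset.mul_sum, add_mul,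
      Finset.sum_add_distrib, mul_assoc] using this
  have hv := hinj (hzero.trans (map_zero _).symm)
  have ha0 : ∑ k, a k * M k i * M k i = 0 := by simpa using congrFun hv 0
  intro j
  have hnonneg : ∀ k ∈ Finset.univ, 0 ≤ a k * M k i * M k i := fun k _ => by
    rw [mul_assoc]
    exact mul_nonneg (ha k).le (mul_self_nonneg _)
  have := (Finset.sum_eq_zero_iff_of_nonneg hnonneg).1 ha0 j (Finset.mem_univ j)
  simpa [(ha j).ne'] using this

/-- In a good manifold, nontrivial combinations of the two forms have corank at most one. -/
theorem IsGoodManifold.le_rank_diagonal {d : ℕ} {a b : Fin d → ℝ} (h : IsGoodManifold d a b)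
    {s t : ℝ} (hst : s ≠ 0 ∨ t ≠ 0) :
    d ≤ (Matrix.diagonal fun k => s * a k + t * b k).rank + 1 := by
  rw [Matrix.rank_diagonal]
  have hcompl := Fintype.card_subtype_compl fun k => s * a k + t * b k = 0
  have hle : Fintype.card {k // s * a k + t * b k = 0} ≤ 1 := by
    rw [Fintype.card_le_one_iff]
    rintro ⟨i, hi⟩ ⟨j, hj⟩
    by_contra hij
    have hdet := h.2 i j fun e => hij (Subtype.ext e)
    have hs : s * (a i * b j - a j * b i) = 0 := by linear_combination b j * hi - b i * hj
    have ht : t * (a i * b j - a j * b i) = 0 := by linear_combination a i * hj - a j * hi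
    rcases hst with hst | hst
    · exact mul_ne_zero hst hdet hs
    · exact mul_ne_zero hst hdet ht
  rw [Fintype.card_fin] at hcompl
  simp only [ne_eq]
  omega

theorem IsGoodManifold.two_mul_rank_le_numVars {d : ℕ} {a b : Fin d → ℝ}
    (h : IsGoodManifold d a b) (M : Matrix (Fin d) (Fin d) ℝ) {M' : Matrix (Fin 2) (Fin 2) ℝ}
    (hM' : M' ≠ 0) :
    2 * M.rank ≤ numVars d 2 (fun l ξ => ∑ j, M' l j * (fun (l : Fin 2) (ξ : Fin d → ℝ) =>
      if l = 0 then ∑ i, a i * ξ i ^ 2 else ∑ i, b i * ξ i ^ 2) j (M.mulVec ξ)) + d + 1 := by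
  obtain ⟨l, hl⟩ : ∃ l, M' l 0 ≠ 0 ∨ M' l 1 ≠ 0 := by
    by_contra! hcon
    refine hM' (Matrix.ext fun l j => ?_)
    fin_cases j
    · exact (hcon l).1
    · exact (hcon l).2
  set D := Matrix.diagonal fun k => M' l 0 * a k + M' l 1 * b k with hD
  have hrank : (M.transpose * (D * M)).rank ≤
      numVars d 2 (fun l ξ => ∑ j, M' l j * (fun (l : Fin 2) (ξ : Fin d → ℝ) =>
        if l = 0 then ∑ i, a i * ξ i ^ 2 else ∑ i, b i * ξ i ^ 2) j (M.mulVec ξ)) := by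
    refine Matrix.rank_le_ncard_of_col_eq_zero _ _ fun i hi j => ?_
    simp only [sum_mul_diagonal_forms, Set.mem_ofPred_eq, not_exists, not_not] at hi
    rw [← sum_mul_eq_zero_of_fderiv_eq_zero (hi l) j, Matrix.mul_apply]
    refine Finset.sum_congr rfl fun k _ => ?_
    rw [hD, Matrix.diagonal_mul, Matrix.transpose_apply]
    ring
  have h1 := M.transpose.rank_add_rank_le_rank_mul_add_card (D * M)
  have h2 := D.rank_add_rank_le_rank_mul_add_card M
  have h3 : d ≤ D.rank + 1 := h.le_rank_diagonal hl
  rw [Matrix.rank_transpose, Fintype.card_fin] at h1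
  rw [Fintype.card_fin] at h2
  omega

/-- **Lemma 5.1.**  For a good manifold with `𝐐 = (P,Q) = (∑ a_iξ_i², ∑ b_iξ_i²)` one has
`𝔡_{d-m,2}(𝐐) ≥ d-m` and `𝔡_{d-m,1}(𝐐) ≥ d-2m-1` for all `0 ≤ m ≤ d`. -/
theorem good_manifold_frakd_bounds
    (d : ℕ) (a b : Fin d → ℝ) (hgood : IsGoodManifold d a b)
    (m : ℕ) (hm : m ≤ d) :
    d - m ≤ frakd d 2
        (fun l ξ => if l = 0 then ∑ i, a i * ξ i ^ 2 else ∑ i, b i * ξ i ^ 2) (d - m) 2 ∧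
    (d : ℤ) - 2 * (m : ℤ) - 1 ≤
      (frakd d 2
        (fun l ξ => if l = 0 then ∑ i, a i * ξ i ^ 2 else ∑ i, b i * ξ i ^ 2) (d - m) 1 : ℤ) := by
  constructor
  · refine le_frakd (Nat.sub_le d m) le_rfl fun M M' hM hM' => ?_
    rw [← hM]
    exact rank_le_numVars_of_rank_eq_two b hgood.1 M hM'
  · have hle : d - 2 * m - 1 ≤ frakd d 2
        (fun l ξ => if l = 0 then ∑ i, a i * ξ i ^ 2 else ∑ i, b i * ξ i ^ 2) (d - m) 1 := by
      refine le_frakd (Nat.sub_le d m) one_le_two fun M M' hM hM' => ?_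
      have hne : M' ≠ 0 := by
        rintro rfl
        simp at hM'
      have := hgood.two_mul_rank_le_numVars M hne
      beta_reduce at this ⊢
      omega
    omega

end
end

section
/- Let Q = (Q_1, …, Q_n) be real quadratic forms in d variables with associated symmetric d×d matrices A_1, …, A_n (so the (i,j)-entry of A_l is (1/2)∂_i∂_j Q_l). Then the infimum of NV(Q∘M) over all invertible matrices M ∈ ℝ^{d×d} equals Row-rank( Σ_{i=1}^n x_i A_i ), where Σ_{i=1}^n x_i A_i is the d×d matrix with entries in the polynomial ring ℝ[x_1,…,x_n] in the indeterminates x_1,…,x_n. -/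
open Classical

noncomputable section

/-- The quadratic form `Q(ξ) = ξᵀ A ξ` with coefficient matrix `A`. -/
def quadOf {d : ℕ} (A : Matrix (Fin d) (Fin d) ℝ) (ξ : Fin d → ℝ) : ℝ :=
  ∑ i, ∑ j, A i j * ξ i * ξ j

/-- `Row-rank` of a matrix with entries in the polynomial ring `ℝ[x₁,…,x_l]`: the dimension
of the `ℝ`-vector space spanned by its rows. -/
def rowRank {d n : ℕ} (B : Matrix (Fin d) (Fin d) (MvPolynomial (Fin n) ℝ)) : ℕ :=
  Module.finrank ℝ
    ↥(Submodule.span ℝ (Set.range (fun i : Fin d => (fun j => B i j : Fin d → MvPolynomial (Fin n) ℝ))))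

/-- The matrix `∑_{i=1}^n x_i A_i` with entries in `ℝ[x₁,…,x_n]`. -/
def pencil {d n : ℕ} (A : Fin n → Matrix (Fin d) (Fin d) ℝ) :
    Matrix (Fin d) (Fin d) (MvPolynomial (Fin n) ℝ) :=
  fun i j => ∑ l : Fin n, MvPolynomial.X l * MvPolynomial.C (A l i j)

/-- A linear map has rank at most the number of vectors of a basis on which it does not vanish. -/
theorem finrank_range_le_ncard_basis_ne_zero {K V W ι : Type*} [Field K] [AddCommGroup V]
    [Module K V] [AddCommGroup W] [Module K W] [Finite ι] (b : Module.Basis ι K V)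
    (f : V →ₗ[K] W) :
    Module.finrank K (LinearMap.range f) ≤ Set.ncard {i | f (b i) ≠ 0} := by
  have hfin : ((fun i => f (b i)) '' {i | f (b i) ≠ 0}).Finite := Set.toFinite _
  have hrange : LinearMap.range f ≤
      Submodule.span K ((fun i => f (b i)) '' {i | f (b i) ≠ 0}) := by
    rw [LinearMap.range_eq_map, ← b.span_eq, Submodule.map_span, Submodule.span_le]
    rintro _ ⟨_, ⟨i, rfl⟩, rfl⟩
    by_cases h : f (b i) = 0
    · simp [h]
    · exact Submodule.subset_span ⟨i, h, rfl⟩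
  have := FiniteDimensional.span_of_finite K hfin
  have := hfin.fintype
  calc Module.finrank K (LinearMap.range f)
      ≤ _ := Submodule.finrank_mono hrange
    _ ≤ _ := finrank_span_le_card _
    _ = Set.ncard ((fun i => f (b i)) '' {i | f (b i) ≠ 0}) := (Set.ncard_eq_toFinset_card' _).symm
    _ ≤ _ := Set.ncard_image_le (Set.toFinite _)

/-- The domain of a linear map has a basis of which at most `rank f` vectors lie outside the
kernel. -/
theorem exists_basis_ncard_ne_zero_le_finrank_range {K V W : Type*} [Field K]
    [AddCommGroup V] [Module K V] [FiniteDimensional K V] [AddCommGroup W] [Module K W]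
    {d : ℕ} (hd : Module.finrank K V = d) (f : V →ₗ[K] W) :
    ∃ b : Module.Basis (Fin d) K V,
      Set.ncard {i | f (b i) ≠ 0} ≤ Module.finrank K (LinearMap.range f) := by
  obtain ⟨C, hC⟩ := Submodule.exists_isCompl (LinearMap.ker f)
  have hsum := Submodule.finrank_add_eq_of_isCompl hC
  have hrank := f.finrank_range_add_finrank_ker
  let b₀ := ((Module.finBasis K (LinearMap.ker f)).prod (Module.finBasis K C)).map
    (Submodule.prodEquivOfIsCompl _ _ hC)
  let e : Fin (Module.finrank K (LinearMap.ker f)) ⊕ Fin (Module.finrank K C) ≃ Fin d :=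
    finSumFinEquiv.trans (finCongr (hsum.trans hd))
  refine ⟨b₀.reindex e, ?_⟩
  have hsub : {i | f (b₀.reindex e i) ≠ 0} ⊆ Set.range (fun j => e (Sum.inr j)) := by
    intro i hi
    obtain ⟨k, rfl⟩ := e.surjective i
    rcases k with k | k
    · exact absurd (by simp [b₀]) hi
    · exact ⟨k, rfl⟩
  calc _ ≤ _ := Set.ncard_le_ncard hsub (Set.toFinite _)
    _ ≤ Module.finrank K C := by
      rw [← Set.image_univ]
      exact (Set.ncard_image_le (Set.toFinite _)).trans (by simp [Set.ncard_univ])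
    _ ≤ _ := by omega

theorem quadOf_hasFDerivAt {d : ℕ} (A : Matrix (Fin d) (Fin d) ℝ) (ξ : Fin d → ℝ) :
    HasFDerivAt (quadOf A) (∑ i, ∑ j, ((A i j * ξ i) • ContinuousLinearMap.proj (R := ℝ) j +
      ξ j • A i j • ContinuousLinearMap.proj (R := ℝ) (φ := fun _ : Fin d => ℝ) i)) ξ :=
  HasFDerivAt.fun_sum fun i _ => HasFDerivAt.fun_sum fun j _ =>
    ((hasFDerivAt_apply i ξ).const_mul (A i j)).mul (hasFDerivAt_apply j ξ)

theorem fderiv_quadOf_mulVec {d : ℕ} {A : Matrix (Fin d) (Fin d) ℝ} (hA : A.IsSymm)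
    (M : Matrix (Fin d) (Fin d) ℝ) (ξ v : Fin d → ℝ) :
    fderiv ℝ (fun ξ => quadOf A (M.mulVec ξ)) ξ v =
      2 * (M.mulVec ξ ⬝ᵥ A.mulVec (M.mulVec v)) := by
  have h := (quadOf_hasFDerivAt A (M.mulVec ξ)).comp ξ
    (LinearMap.toContinuousLinearMap M.mulVecLin).hasFDerivAt
  have h' := congrArg (fun L => L v) h.fderiv
  refine Eq.trans h' ?_
  generalize hη : M.mulVec ξ = η
  generalize hw : M.mulVec v = w
  simp only [ContinuousLinearMap.comp_apply, _root_.sum_apply,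
    _root_.add_apply, _root_.smul_apply,
    ContinuousLinearMap.proj_apply, LinearMap.coe_toContinuousLinearMap', smul_eq_mul,
    Matrix.mulVecLin_apply, hw, Finset.sum_add_distrib]
  rw [Finset.sum_comm (f := fun i j => η j * (A i j * w i)), two_mul]
  congr 1 <;> simp only [dotProduct, Matrix.mulVec, Finset.mul_sum]
  · exact Finset.sum_congr rfl fun i _ => Finset.sum_congr rfl fun j _ => by ring
  · exact Finset.sum_congr rfl fun i _ => Finset.sum_congr rfl fun j _ => by rw [hA.apply]

/-- The linear map sending a coefficient vector to the corresponding combination of rows. -/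
def rowCombination {d n : ℕ} (B : Matrix (Fin d) (Fin d) (MvPolynomial (Fin n) ℝ)) :
    (Fin d → ℝ) →ₗ[ℝ] (Fin d → MvPolynomial (Fin n) ℝ) :=
  Fintype.linearCombination ℝ fun i j => B i j

theorem rowRank_eq_finrank_range {d n : ℕ}
    (B : Matrix (Fin d) (Fin d) (MvPolynomial (Fin n) ℝ)) :
    rowRank B = Module.finrank ℝ (LinearMap.range (rowCombination B)) := by
  rw [rowCombination, Fintype.range_linearCombination, rowRank]

theorem rowCombination_pencil_eq_zero_iff {d n : ℕ} {A : Fin n → Matrix (Fin d) (Fin d) ℝ}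
    (hA : ∀ l, (A l).IsSymm) (v : Fin d → ℝ) :
    rowCombination (pencil A) v = 0 ↔ ∀ l, (A l).mulVec v = 0 := by
  have key : ∀ j, rowCombination (pencil A) v j =
      ∑ l, MvPolynomial.monomial (Finsupp.single l 1) ((A l).mulVec v j) := by
    intro j
    simp only [rowCombination, Fintype.linearCombination_apply, Finset.sum_apply, Pi.smul_apply,
      pencil, Finset.smul_sum, Matrix.mulVec, dotProduct, map_sum]
    rw [Finset.sum_comm]
    refine Finset.sum_congr rfl fun l _ => Finset.sum_congr rfl fun i _ => ?_
    rw [mul_comm (MvPolynomial.X l), MvPolynomial.C_mul_X_eq_monomial,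
      MvPolynomial.smul_monomial, smul_eq_mul, (hA l).apply, mul_comm]
  constructor
  · intro h l
    ext j
    have hc := congrArg (MvPolynomial.coeff (Finsupp.single l 1)) ((key j).symm.trans (congrFun h j))
    simpa [MvPolynomial.coeff_sum, MvPolynomial.coeff_monomial,
      Finsupp.single_left_inj (one_ne_zero : (1 : ℕ) ≠ 0)] using hc
  · intro h
    ext1 j
    simp [key, h]

theorem numVars_quadOf_mulVec {d n : ℕ} {A : Fin n → Matrix (Fin d) (Fin d) ℝ}
    (hA : ∀ l, (A l).IsSymm) {M : Matrix (Fin d) (Fin d) ℝ} (hM : IsUnit M) :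
    numVars d n (fun l ξ => quadOf (A l) (M.mulVec ξ)) =
      Set.ncard {i | rowCombination (pencil A) (M.mulVec (Pi.single i 1)) ≠ 0} := by
  rw [numVars]
  congr 1
  ext i
  simp only [Set.mem_ofPred_eq, ne_eq, rowCombination_pencil_eq_zero_iff hA, not_forall,
    fderiv_quadOf_mulVec (hA _)]
  refine exists_congr fun l => ?_
  rw [← not_forall, not_iff_not]
  constructor
  · intro h
    refine dotProduct_eq_zero _ fun w => ?_
    obtain ⟨ξ, rfl⟩ := (Matrix.mulVec_surjective_iff_isUnit.mpr hM) w
    rw [dotProduct_comm]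
    simpa using h ξ
  · intro h ξ
    rw [h, dotProduct_zero, mul_zero]

/-- **Lemma A.6.**  Let `Q = (Q₁,…,Q_n)` be real quadratic forms in `d` variables with
associated symmetric matrices `A₁,…,A_n`.  Then
`inf { NV(Q∘M) : M ∈ ℝ^{d×d} invertible } = Row-rank(∑ x_i A_i)`. -/
theorem inf_numVars_eq_rowRank_pencil
    (d n : ℕ) (A : Fin n → Matrix (Fin d) (Fin d) ℝ) (hA : ∀ l, (A l).IsSymm) :
    sInf {r : ℕ | ∃ M : Matrix (Fin d) (Fin d) ℝ, IsUnit M ∧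
        r = numVars d n (fun l ξ => quadOf (A l) (M.mulVec ξ))} = rowRank (pencil A) := by
  refine le_antisymm ?_ ?_
  · obtain ⟨b, hb⟩ := exists_basis_ncard_ne_zero_le_finrank_range
      (Module.finrank_fin_fun ℝ) (rowCombination (pencil A))
    have hM : IsUnit ((Pi.basisFun ℝ (Fin d)).toMatrix b) := by
      have := (Pi.basisFun ℝ (Fin d)).invertibleToMatrix b
      exact isUnit_of_invertible _
    refine le_trans (Nat.sInf_le (m := numVars d n fun l ξ =>
      quadOf (A l) (((Pi.basisFun ℝ (Fin d)).toMatrix b).mulVec ξ)) ?_) ?_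
    · exact ⟨_, hM, rfl⟩
    have hcol : ∀ i, ((Pi.basisFun ℝ (Fin d)).toMatrix b).mulVec (Pi.single i 1) = b i := by
      intro i
      ext j
      simp [Module.Basis.toMatrix_apply]
    rw [numVars_quadOf_mulVec hA hM, rowRank_eq_finrank_range]
    simpa only [hcol] using hb
  · have hne : {r : ℕ | ∃ M : Matrix (Fin d) (Fin d) ℝ, IsUnit M ∧
        r = numVars d n (fun l ξ => quadOf (A l) (M.mulVec ξ))}.Nonempty :=
      ⟨_, 1, isUnit_one, rfl⟩
    refine le_csInf hne ?_
    rintro _ ⟨M, hM, rfl⟩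
    rw [numVars_quadOf_mulVec hA hM, rowRank_eq_finrank_range]
    have := hM.invertible
    have h := finrank_range_le_ncard_basis_ne_zero
      ((Pi.basisFun ℝ (Fin d)).map (Matrix.toLin'OfInv (invOf_mul_self M) (mul_invOf_self M)))
      (rowCombination (pencil A))
    simpa [Matrix.toLin'OfInv] using h

end
end

section
/- Let a, b ≥ 1 be integers, let P(η, ξ) be a real polynomial in the variables (η, ξ) ∈ ℝ^a × ℝ^b, and let m be an integer. Then the set {η ∈ ℝ^a : the Hausdorff dimension of {ξ ∈ ℝ^b : P(η, ξ) = 0} equals m} is a semi-algebraic subset of ℝ^a. -/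
open MeasureTheory ENNReal

noncomputable section

/-- A set `Z ⊆ ℝ^a` is semi-algebraic if it is a finite union of sets of the form
`{x : P₁(x) = ⋯ = P_l(x) = 0, P_{l+1}(x) > 0, …, P_{l+k'}(x) > 0}` with real
polynomials `P_i`. -/
def IsSemialgebraic (a : ℕ) (Z : Set (Fin a → ℝ)) : Prop :=
  ∃ (N : ℕ) (l k : Fin N → ℕ)
    (Peq : (i : Fin N) → Fin (l i) → MvPolynomial (Fin a) ℝ)
    (Pgt : (i : Fin N) → Fin (k i) → MvPolynomial (Fin a) ℝ),
    Z = ⋃ i, {x | (∀ s, MvPolynomial.eval x (Peq i s) = 0) ∧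
                  (∀ s, 0 < MvPolynomial.eval x (Pgt i s))}

/-! ### Sign conditions on univariate polynomials -/

section SignConditions

open Polynomial

lemma monotoneOn_eval_of_derivative_nonneg (p : ℝ[X]) {a b : ℝ}
    (h : ∀ s ∈ Set.Icc a b, 0 ≤ (derivative p).eval s) :
    MonotoneOn (fun s => p.eval s) (Set.Icc a b) := by
  refine monotoneOn_of_deriv_nonneg (convex_Icc a b) p.continuous.continuousOn
    p.differentiable.differentiableOn fun s hs => ?_
  rw [Polynomial.deriv]
  exact h s (interior_subset hs)

lemma antitoneOn_eval_of_derivative_nonpos (p : ℝ[X]) {a b : ℝ}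
    (h : ∀ s ∈ Set.Icc a b, (derivative p).eval s ≤ 0) :
    AntitoneOn (fun s => p.eval s) (Set.Icc a b) := by
  refine antitoneOn_of_deriv_nonpos (convex_Icc a b) p.continuous.continuousOn
    p.differentiable.differentiableOn fun s hs => ?_
  rw [Polynomial.deriv]
  exact h s (interior_subset hs)

lemma sign_nonneg_or_nonpos_of_forall_eq (p : ℝ[X]) {a : ℝ} {S : Set ℝ}
    (h : ∀ s ∈ S, SignType.sign (p.eval s) = SignType.sign (p.eval a)) :
    (0 ≤ p.eval a ∧ ∀ s ∈ S, 0 ≤ p.eval s) ∨ (p.eval a ≤ 0 ∧ ∀ s ∈ S, p.eval s ≤ 0) := by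
  rcases le_total 0 (p.eval a) with h0 | h0
  · refine Or.inl ⟨h0, fun s hs => ?_⟩
    rw [← sign_nonneg_iff, h s hs, sign_nonneg_iff]
    exact h0
  · refine Or.inr ⟨h0, fun s hs => ?_⟩
    rw [← sign_nonpos_iff, h s hs, sign_nonpos_iff]
    exact h0

variable {A : Type*} [CommRing A]

/-- The points `t` and `u` have the same sign vector for the specializations of the polynomials
in `E` by `φ` and `ψ` respectively. -/
def SameSigns (E : Set A[X]) (φ ψ : A →+* ℝ) (t u : ℝ) : Prop :=
  ∀ f ∈ E, SignType.sign ((f.map φ).eval t) = SignType.sign ((f.map ψ).eval u)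

/-- `E` contains the derivatives of its nonconstant members. -/
def DerivativeClosed (E : Set A[X]) : Prop :=
  ∀ f ∈ E, f.natDegree ≠ 0 → derivative f ∈ E

namespace SameSigns

variable {E : Set A[X]} {φ ψ χ : A →+* ℝ} {s t u v : ℝ}

lemma mono {E' : Set A[X]} (h : SameSigns E φ ψ t u) (hE : E' ⊆ E) : SameSigns E' φ ψ t u :=
  fun f hf => h f (hE hf)

lemma symm (h : SameSigns E φ ψ t u) : SameSigns E ψ φ u t :=
  fun f hf => (h f hf).symm

lemma trans (h : SameSigns E φ ψ t u) (h' : SameSigns E ψ χ u v) : SameSigns E φ χ t v :=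
  fun f hf => (h f hf).trans (h' f hf)

end SameSigns

lemma DerivativeClosed.sep_natDegree_lt {E : Set A[X]} (hE : DerivativeClosed E) (n : ℕ) :
    DerivativeClosed {f ∈ E | f.natDegree < n} := by
  rintro f ⟨hf, hn⟩ h0
  exact ⟨hE f hf h0, (natDegree_derivative_lt h0).trans hn⟩

/-- Thom's lemma: sign conditions on a family closed under derivatives define convex sets. -/
lemma SameSigns.of_mem_Icc {E : Set A[X]} (hE : DerivativeClosed E) {φ : A →+* ℝ} {a b : ℝ}
    (h : SameSigns E φ φ a b) {s : ℝ} (hs : s ∈ Set.Icc a b) : SameSigns E φ φ a s := by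
  suffices H : ∀ n, ∀ f ∈ E, f.natDegree = n → ∀ s ∈ Set.Icc a b,
      SignType.sign ((f.map φ).eval a) = SignType.sign ((f.map φ).eval s) from
    fun f hf => H _ f hf rfl s hs
  intro n
  induction n using Nat.strong_induction_on with
  | _ n ih =>
  intro f hf hn s hs
  have hab : a ≤ b := hs.1.trans hs.2
  by_cases h0 : f.natDegree = 0
  · rw [eq_C_of_natDegree_eq_zero h0]
    simp
  have hd := ih _ (hn ▸ natDegree_derivative_lt h0) _ (hE f hf h0) rfl
  have hfab := h f hf
  have hsab : ∀ x ∈ Set.Icc a b, SignType.sign (((derivative f).map φ).eval x) =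
      SignType.sign (((derivative f).map φ).eval a) := fun x hx => (hd x hx).symm
  rcases sign_nonneg_or_nonpos_of_forall_eq _ hsab with ⟨-, hd⟩ | ⟨-, hd⟩
  · rw [← derivative_map] at hd
    have hm := monotoneOn_eval_of_derivative_nonneg _ hd
    refine le_antisymm (SignType.sign.monotone (hm ⟨le_rfl, hab⟩ hs hs.1)) ?_
    rw [hfab]
    exact SignType.sign.monotone (hm hs ⟨hab, le_rfl⟩ hs.2)
  · rw [← derivative_map] at hd
    have hm := antitoneOn_eval_of_derivative_nonpos _ hd
    refine le_antisymm ?_ (SignType.sign.monotone (hm ⟨le_rfl, hab⟩ hs hs.1))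
    rw [hfab]
    exact SignType.sign.monotone (hm hs ⟨hab, le_rfl⟩ hs.2)

/-- Points with distinct sign vectors for a family closed under derivatives are ordered in a way
that depends only on the sign vectors. -/
lemma SameSigns.lt_or_sameSigns {E : Set A[X]} (hE : DerivativeClosed E) {φ ψ : A →+* ℝ}
    {t t' u u' : ℝ} (h : SameSigns E φ ψ t u) (h' : SameSigns E φ ψ t' u') (htt : t < t') :
    u < u' ∨ (SameSigns E φ ψ t u' ∧ SameSigns E φ ψ t' u) := by
  by_cases huu : u < u'
  · exact Or.inl huu
  push Not at huu
  suffices H : SameSigns E φ φ t t' from Or.inr ⟨H.trans h', H.symm.trans h⟩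
  suffices H : ∀ n, ∀ f ∈ E, f.natDegree = n →
      SignType.sign ((f.map φ).eval t) = SignType.sign ((f.map φ).eval t') from
    fun f hf => H _ f hf rfl
  intro n
  induction n using Nat.strong_induction_on with
  | _ n ih =>
  intro f hf hn
  by_cases h0 : f.natDegree = 0
  · rw [eq_C_of_natDegree_eq_zero h0]
    simp
  have hEn := hE.sep_natDegree_lt n
  have hmem : derivative f ∈ {f ∈ E | f.natDegree < n} :=
    ⟨hE f hf h0, hn ▸ natDegree_derivative_lt h0⟩
  have ht : SameSigns {f ∈ E | f.natDegree < n} φ φ t t' := fun g hg => ih _ hg.2 g hg.1 rfl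
  have hu : SameSigns {f ∈ E | f.natDegree < n} ψ ψ u' u :=
    ((h'.mono fun _ hx => hx.1).symm.trans ht.symm).trans (h.mono fun _ hx => hx.1)
  have hdt : ∀ x ∈ Set.Icc t t', SignType.sign (((derivative f).map φ).eval x) =
      SignType.sign (((derivative f).map φ).eval t) := fun x hx =>
    (ht.of_mem_Icc hEn hx _ hmem).symm
  have hdu : ∀ x ∈ Set.Icc u' u, SignType.sign (((derivative f).map ψ).eval x) =
      SignType.sign (((derivative f).map φ).eval t) := fun x hx =>
    (((h.mono fun _ hx => hx.1).trans (hu.symm.trans (hu.of_mem_Icc hEn hx))) _ hmem).symm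
  have hft := h f hf
  have hft' := h' f hf
  rcases sign_nonneg_or_nonpos_of_forall_eq _ hdt with ⟨h0, hd⟩ | ⟨h0, hd⟩
  · have hd' : ∀ x ∈ Set.Icc u' u, 0 ≤ ((derivative f).map ψ).eval x := fun x hx => by
      rw [← sign_nonneg_iff, hdu x hx, sign_nonneg_iff]
      exact h0
    rw [← derivative_map] at hd hd'
    have hm := monotoneOn_eval_of_derivative_nonneg _ hd
    have hm' := monotoneOn_eval_of_derivative_nonneg _ hd'
    refine le_antisymm (SignType.sign.monotone (hm ⟨le_rfl, htt.le⟩ ⟨htt.le, le_rfl⟩ htt.le)) ?_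
    rw [hft, hft']
    exact SignType.sign.monotone (hm' ⟨le_rfl, huu⟩ ⟨huu, le_rfl⟩ huu)
  · have hd' : ∀ x ∈ Set.Icc u' u, ((derivative f).map ψ).eval x ≤ 0 := fun x hx => by
      rw [← sign_nonpos_iff, hdu x hx, sign_nonpos_iff]
      exact h0
    rw [← derivative_map] at hd hd'
    have hm := antitoneOn_eval_of_derivative_nonpos _ hd
    have hm' := antitoneOn_eval_of_derivative_nonpos _ hd'
    refine le_antisymm ?_ (SignType.sign.monotone (hm ⟨le_rfl, htt.le⟩ ⟨htt.le, le_rfl⟩ htt.le))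
    rw [hft, hft']
    exact SignType.sign.monotone (hm' ⟨le_rfl, huu⟩ ⟨huu, le_rfl⟩ huu)

end SignConditions

section SignCorrespondence

open Polynomial

/-- A correspondence `R` between two copies of the real line, matching two closed sets `K` and `L`
of marked points, which is compatible with the order, with the signs of `P` and `Q` at marked
points and with the signs of their derivatives everywhere. -/
structure SignCorrespondence (P Q : ℝ[X]) (K L : Set ℝ) (R : ℝ → ℝ → Prop) : Prop where
  isClosed_left : IsClosed K
  isClosed_right : IsClosed L
  exists_right : ∀ t, ∃ u, R t u
  exists_left : ∀ u, ∃ t, R t u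
  mem_iff : ∀ {t u}, R t u → (t ∈ K ↔ u ∈ L)
  order : ∀ {t t' u u'}, R t u → R t' u' → t < t' → u < u' ∨ (R t u' ∧ R t' u)
  sign_eq : ∀ {t u}, R t u → t ∈ K → SignType.sign (P.eval t) = SignType.sign (Q.eval u)
  sign_derivative : ∀ {t u}, R t u →
    SignType.sign ((derivative P).eval t) = SignType.sign ((derivative Q).eval u)
  move_left : ∀ {t t' u}, R t u → (∀ s ∈ Set.uIcc t t', s ∉ K) → R t' u
  move_right : ∀ {t u u'}, R t u → (∀ s ∈ Set.uIcc u u', s ∉ L) → R t u'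
  natDegree_ne_zero : Q.natDegree ≠ 0

namespace SignCorrespondence

variable {P Q : ℝ[X]} {K L : Set ℝ} {R : ℝ → ℝ → Prop}

lemma neg (h : SignCorrespondence P Q K L R) : SignCorrespondence (-P) (-Q) K L R where
  isClosed_left := h.isClosed_left
  isClosed_right := h.isClosed_right
  exists_right := h.exists_right
  exists_left := h.exists_left
  mem_iff := h.mem_iff
  order := h.order
  sign_eq hR ht := by simpa [Left.sign_neg] using h.sign_eq hR ht
  sign_derivative hR := by simpa [Left.sign_neg] using h.sign_derivative hR
  move_left := h.move_left
  move_right := h.move_right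
  natDegree_ne_zero := by simpa using h.natDegree_ne_zero

lemma neg_mem_uIcc {a b s : ℝ} (hs : s ∈ Set.uIcc (-a) b) : -s ∈ Set.uIcc a (-b) := by
  rw [Set.mem_uIcc] at hs ⊢
  grind

lemma reflect (h : SignCorrespondence P Q K L R) :
    SignCorrespondence (P.comp (-X)) (Q.comp (-X)) (Neg.neg ⁻¹' K) (Neg.neg ⁻¹' L)
      (fun t u => R (-t) (-u)) where
  isClosed_left := h.isClosed_left.preimage continuous_neg
  isClosed_right := h.isClosed_right.preimage continuous_neg
  exists_right t := by
    obtain ⟨u, hu⟩ := h.exists_right (-t)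
    exact ⟨-u, by simpa using hu⟩
  exists_left u := by
    obtain ⟨t, ht⟩ := h.exists_left (-u)
    exact ⟨-t, by simpa using ht⟩
  mem_iff hR := h.mem_iff hR
  order {t t' u u'} hR hR' htt := by
    rcases h.order hR' hR (neg_lt_neg htt) with hu | ⟨h1, h2⟩
    · exact Or.inl (neg_lt_neg_iff.mp hu)
    · exact Or.inr ⟨h2, h1⟩
  sign_eq hR ht := by simpa using h.sign_eq hR ht
  sign_derivative hR := by simpa [derivative_comp, Left.sign_neg] using h.sign_derivative hR
  move_left hR hs := h.move_left hR fun s hs' hK =>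
    hs (-s) (by simpa using neg_mem_uIcc hs') (by simpa using hK)
  move_right hR hs := h.move_right hR fun s hs' hK =>
    hs (-s) (by simpa using neg_mem_uIcc hs') (by simpa using hK)
  natDegree_ne_zero := by simpa [natDegree_comp] using h.natDegree_ne_zero

lemma strictMonoOn_left (h : SignCorrespondence P Q K L R) {t s u : ℝ} (hR : R t u)
    (hP : 0 < (derivative P).eval t) (hs : ∀ x ∈ Set.Ico t s, x ∉ K) :
    StrictMonoOn (fun x => P.eval x) (Set.Icc t s) := by
  refine strictMonoOn_of_deriv_pos (convex_Icc t s) P.continuous.continuousOn fun x hx => ?_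
  rw [interior_Icc] at hx
  have hRx : R x u := h.move_left hR fun y hy => by
    rw [Set.uIcc_of_le hx.1.le] at hy
    exact hs y ⟨hy.1, hy.2.trans_lt hx.2⟩
  rw [Polynomial.deriv, ← sign_eq_one_iff, h.sign_derivative hRx, ← h.sign_derivative hR,
    sign_eq_one_iff]
  exact hP

lemma strictMonoOn_right (h : SignCorrespondence P Q K L R) {t u v : ℝ} (hR : R t u)
    (hP : 0 < (derivative P).eval t) (hv : ∀ x ∈ Set.Ico u v, x ∉ L) :
    StrictMonoOn (fun x => Q.eval x) (Set.Icc u v) := by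
  refine strictMonoOn_of_deriv_pos (convex_Icc u v) Q.continuous.continuousOn fun x hx => ?_
  rw [interior_Icc] at hx
  have hRx : R t x := h.move_right hR fun y hy => by
    rw [Set.uIcc_of_le hx.1.le] at hy
    exact hv y ⟨hy.1, hy.2.trans_lt hx.2⟩
  rw [Polynomial.deriv, ← sign_eq_one_iff, ← h.sign_derivative hRx, sign_eq_one_iff]
  exact hP

lemma exists_pos_of_pos_derivative (h : SignCorrespondence P Q K L R) {t u : ℝ} (hR : R t u)
    (ht : t ∉ K) (hP : 0 < (derivative P).eval t) (hPt : 0 ≤ P.eval t) :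
    ∃ v, u < v ∧ 0 < Q.eval v ∧ ∀ x ∈ Set.Ico u v, x ∉ L := by
  have hu : u ∉ L := fun hu => ht ((h.mem_iff hR).2 hu)
  by_cases hL : (L ∩ Set.Ici u).Nonempty
  · have hbL : BddBelow (L ∩ Set.Ici u) := ⟨u, fun x hx => hx.2⟩
    have hvmem := (h.isClosed_right.inter isClosed_Ici).csInf_mem hL hbL
    set v := sInf (L ∩ Set.Ici u) with hvdef
    have huv : u < v := lt_of_le_of_ne hvmem.2 fun e => hu (e ▸ hvmem.1)
    have hvfree : ∀ x ∈ Set.Ico u v, x ∉ L := fun x hx hxL =>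
      not_lt.2 (csInf_le hbL ⟨hxL, hx.1⟩) hx.2
    obtain ⟨s₁, hs₁⟩ := h.exists_left v
    have hs₁K : s₁ ∈ K := (h.mem_iff hs₁).2 hvmem.1
    have hts₁ : t < s₁ := by
      rcases lt_trichotomy t s₁ with hlt | heq | hgt
      · exact hlt
      · exact absurd hs₁K (heq ▸ ht)
      · rcases h.order hs₁ hR hgt with h1 | ⟨h1, -⟩
        · exact absurd h1 huv.not_gt
        · exact absurd ((h.mem_iff h1).1 hs₁K) hu
    have hK : (K ∩ Set.Ici t).Nonempty := ⟨s₁, hs₁K, hts₁.le⟩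
    have hbK : BddBelow (K ∩ Set.Ici t) := ⟨t, fun x hx => hx.2⟩
    have hsmem := (h.isClosed_left.inter isClosed_Ici).csInf_mem hK hbK
    set s := sInf (K ∩ Set.Ici t) with hsdef
    have hts : t < s := lt_of_le_of_ne hsmem.2 fun e => ht (e ▸ hsmem.1)
    have hsfree : ∀ x ∈ Set.Ico t s, x ∉ K := fun x hx hxK =>
      not_lt.2 (csInf_le hbK ⟨hxK, hx.1⟩) hx.2
    have hss₁ : s ≤ s₁ := csInf_le hbK ⟨hs₁K, hts₁.le⟩
    have hRsv : R s v := by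
      rcases hss₁.eq_or_lt with heq | hlt
      · rwa [heq]
      obtain ⟨v', hv'⟩ := h.exists_right s
      have hv'L : v' ∈ L := (h.mem_iff hv').1 hsmem.1
      rcases h.order hv' hs₁ hlt with h1 | ⟨h1, -⟩
      · exfalso
        rcases h.order hR hv' hts with h2 | ⟨h2, -⟩
        · exact hvfree v' ⟨h2.le, h1⟩ hv'L
        · exact ht ((h.mem_iff h2).2 hv'L)
      · exact h1
    refine ⟨v, huv, ?_, hvfree⟩
    have hPs : P.eval t < P.eval s :=
      h.strictMonoOn_left hR hP hsfree ⟨le_rfl, hts.le⟩ ⟨hts.le, le_rfl⟩ hts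
    rw [← sign_eq_one_iff, ← h.sign_eq hRsv hsmem.1, sign_eq_one_iff]
    exact hPt.trans_lt hPs
  · have hfree : ∀ x, u ≤ x → x ∉ L := fun x hx hxL => hL ⟨x, hxL, hx⟩
    have hdeg : 0 < Q.degree := natDegree_pos_iff_degree_pos.1
      (Nat.pos_of_ne_zero h.natDegree_ne_zero)
    have htend := Q.abs_tendsto_atTop hdeg
    obtain ⟨v, hv1, hv2⟩ := ((htend.eventually_gt_atTop (|Q.eval u|)).and
      (Filter.eventually_gt_atTop u)).exists
    refine ⟨v, hv2, ?_, fun x hx => hfree x hx.1⟩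
    have hlt : Q.eval u < Q.eval v := h.strictMonoOn_right hR hP
      (fun x hx => hfree x hx.1) ⟨le_rfl, hv2.le⟩ ⟨hv2.le, le_rfl⟩ hv2
    by_contra hneg
    push Not at hneg
    rw [abs_of_nonpos hneg, abs_of_nonpos (hlt.le.trans hneg)] at hv1
    linarith

lemma exists_sign_eq_of_pos_derivative (h : SignCorrespondence P Q K L R) {t u : ℝ} (hR : R t u)
    (ht : t ∉ K) (hP : 0 < (derivative P).eval t)
    (hlt : SignType.sign (Q.eval u) < SignType.sign (P.eval t)) :
    ∃ u', R t u' ∧ SignType.sign (P.eval t) = SignType.sign (Q.eval u') := by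
  have hPt : 0 ≤ P.eval t := by
    by_contra hneg
    push Not at hneg
    rw [sign_neg hneg] at hlt
    exact absurd hlt (by cases SignType.sign (Q.eval u) <;> decide)
  obtain ⟨v, huv, hv, hfree⟩ := h.exists_pos_of_pos_derivative hR ht hP hPt
  have hmove : ∀ x ∈ Set.Ico u v, R t x := fun x hx => h.move_right hR fun y hy => by
    rw [Set.uIcc_of_le hx.1] at hy
    exact hfree y ⟨hy.1, hy.2.trans_lt hx.2⟩
  rcases hPt.eq_or_lt with h0 | h0
  · rw [← h0, sign_zero] at hlt ⊢
    have hQu : Q.eval u < 0 := by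
      by_contra hneg
      push Not at hneg
      exact absurd (sign_nonneg_iff.2 hneg) (not_le.2 hlt)
    obtain ⟨x, hx, hx0⟩ := intermediate_value_Ioo huv.le Q.continuous.continuousOn
      (show (0 : ℝ) ∈ Set.Ioo (Q.eval u) (Q.eval v) from ⟨hQu, hv⟩)
    exact ⟨x, hmove x ⟨hx.1.le, hx.2⟩, by simp only at hx0; rw [hx0, sign_zero]⟩
  · have hev : ∀ᶠ x in nhds v, 0 < Q.eval x := Q.continuous.continuousAt.eventually
      (lt_mem_nhds hv)
    obtain ⟨x, hx1, hx2⟩ := ((hev.filter_mono nhdsWithin_le_nhds).and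
      (Ioo_mem_nhdsLT huv)).exists
    exact ⟨x, hmove x ⟨hx2.1.le, hx2.2⟩, by rw [sign_pos h0, sign_pos hx1]⟩

lemma exists_sign_eq_of_lt (h : SignCorrespondence P Q K L R) {t u : ℝ} (hR : R t u)
    (ht : t ∉ K) (hP : (derivative P).eval t ≠ 0)
    (hlt : SignType.sign (Q.eval u) < SignType.sign (P.eval t)) :
    ∃ u', R t u' ∧ SignType.sign (P.eval t) = SignType.sign (Q.eval u') := by
  rcases hP.lt_or_gt with hneg | hpos
  · obtain ⟨u', hu', hs⟩ := h.reflect.exists_sign_eq_of_pos_derivative (t := -t) (u := -u)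
      (by simpa using hR) (by simpa using ht) (by simpa [derivative_comp] using hneg)
      (by simpa using hlt)
    exact ⟨-u', by simpa using hu', by simpa using hs⟩
  · exact h.exists_sign_eq_of_pos_derivative hR ht hpos hlt

lemma exists_sign_eq (h : SignCorrespondence P Q K L R) {t u : ℝ} (hR : R t u)
    (ht : t ∉ K) (hP : (derivative P).eval t ≠ 0) :
    ∃ u', R t u' ∧ SignType.sign (P.eval t) = SignType.sign (Q.eval u') := by
  rcases lt_trichotomy (SignType.sign (Q.eval u)) (SignType.sign (P.eval t)) with hlt | heq | hgt
  · exact h.exists_sign_eq_of_lt hR ht hP hlt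
  · exact ⟨u, hR, heq.symm⟩
  · obtain ⟨u', hu', hs⟩ := h.neg.exists_sign_eq_of_lt hR ht (by simpa using hP)
      (by rw [eval_neg, eval_neg, Left.sign_neg, Left.sign_neg]
          exact SignType.neg_lt_neg_iff.2 hgt)
    exact ⟨u', hu', by simpa [Left.sign_neg] using hs⟩

end SignCorrespondence

end SignCorrespondence

section SignTransfer

open Polynomial

variable {A : Type*} [CommRing A]

lemma exists_pseudoRem (f : A[X]) (hf : f.natDegree ≠ 0) (p : A[X]) :
    ∃ (r q : A[X]) (k : ℕ), r.natDegree < f.natDegree ∧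
      C f.leadingCoeff ^ k * p = q * f + r := by
  suffices H : ∀ n, ∀ p : A[X], p.natDegree = n → ∃ (r q : A[X]) (k : ℕ),
      r.natDegree < f.natDegree ∧ C f.leadingCoeff ^ k * p = q * f + r from H _ p rfl
  intro n
  induction n using Nat.strong_induction_on with
  | _ n ih =>
  intro p hp
  by_cases hlt : p.natDegree < f.natDegree
  · exact ⟨p, 0, 0, hlt, by simp⟩
  push Not at hlt
  set p₁ := C f.leadingCoeff * p - C p.leadingCoeff * X ^ (n - f.natDegree) * f with hp₁
  have hle : p₁.natDegree ≤ n := by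
    refine (natDegree_sub_le _ _).trans (max_le ?_ ?_)
    · exact (natDegree_C_mul_le _ _).trans hp.le
    · refine natDegree_mul_le.trans ?_
      have := natDegree_C_mul_X_pow_le p.leadingCoeff (n - f.natDegree)
      omega
  have hcoeff : p₁.coeff n = 0 := by
    have h1 : (C p.leadingCoeff * X ^ (n - f.natDegree) * f).coeff n =
        p.leadingCoeff * f.leadingCoeff := by
      rw [mul_assoc, coeff_C_mul, coeff_X_pow_mul', if_pos (Nat.sub_le _ _)]
      congr 2
      omega
    rw [hp₁, coeff_sub, h1, coeff_C_mul, ← hp, coeff_natDegree]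
    ring
  have hlt₁ : p₁.natDegree < n := by
    have := natDegree_le_pred hle hcoeff
    omega
  obtain ⟨r, q, k, hr, he⟩ := ih _ hlt₁ p₁ rfl
  refine ⟨r, q + C f.leadingCoeff ^ k * (C p.leadingCoeff * X ^ (n - f.natDegree)), k + 1, hr, ?_⟩
  rw [hp₁] at he
  linear_combination he

open Classical in
/-- A pseudo-remainder of `p` by a nonconstant polynomial `f`. -/
def pseudoRem (p f : A[X]) : A[X] :=
  if hf : f.natDegree ≠ 0 then (exists_pseudoRem f hf p).choose else 0

lemma pseudoRem_spec (p : A[X]) {f : A[X]} (hf : f.natDegree ≠ 0) :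
    ∃ (q : A[X]) (k : ℕ), (pseudoRem p f).natDegree < f.natDegree ∧
      C f.leadingCoeff ^ k * p = q * f + pseudoRem p f := by
  rw [pseudoRem, dif_pos hf]
  exact (exists_pseudoRem f hf p).choose_spec

/-- The polynomials derived from `p` and `f` that are needed to eliminate a variable. -/
def eliminants (p f : A[X]) : Set A[X] :=
  {g | f.natDegree ≠ 0 ∧ f.natDegree ≤ p.natDegree ∧
    (g = derivative f ∨ g = f.eraseLead ∨ g = C f.leadingCoeff ∨ g = pseudoRem p f)}

lemma finite_eliminants (p f : A[X]) : (eliminants p f).Finite := by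
  refine Set.Finite.subset (s := {derivative f, f.eraseLead, C f.leadingCoeff, pseudoRem p f})
    (by simp) ?_
  rintro g ⟨-, -, h⟩
  simpa using h

lemma natDegree_lt_of_mem_eliminants {p f g : A[X]} (h : g ∈ eliminants p f) :
    g.natDegree < f.natDegree ∧ g.natDegree < p.natDegree := by
  obtain ⟨h0, hle, h⟩ := h
  suffices H : g.natDegree < f.natDegree from ⟨H, H.trans_le hle⟩
  rcases h with rfl | rfl | rfl | rfl
  · exact natDegree_derivative_lt h0
  · exact (eraseLead_natDegree_le f).trans_lt (by omega)
  · rw [natDegree_C]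
    omega
  · obtain ⟨q, k, hr, -⟩ := pseudoRem_spec p h0
    exact hr

/-- A family of polynomials stable under the operations used in variable elimination. -/
def EliminationClosed (E : Set A[X]) : Prop :=
  ∀ p ∈ E, ∀ f ∈ E, eliminants p f ⊆ E

/-- A finite set has a finite closure under a binary multivalued operation which strictly
decreases a rank. -/
lemma Set.Finite.exists_finite_closed_superset {α : Type*} (rank : α → ℕ) (op : α → α → Set α)
    (hop : ∀ x y, (op x y).Finite)
    (hrank : ∀ x y, ∀ z ∈ op x y, rank z < rank y ∧ rank z < rank x)
    {F : Set α} (hF : F.Finite) :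
    ∃ E : Set α, F ⊆ E ∧ E.Finite ∧ ∀ x ∈ E, ∀ y ∈ E, op x y ⊆ E := by
  obtain ⟨D, hD⟩ : ∃ D, ∀ x ∈ F, rank x < D := by
    obtain ⟨D, hD⟩ := (hF.image rank).bddAbove
    exact ⟨D + 1, fun x hx => Nat.lt_succ_of_le (hD ⟨x, hx, rfl⟩)⟩
  have key : ∀ k, ∃ E : Set α, F ⊆ E ∧ E.Finite ∧ (∀ x ∈ E, rank x < D) ∧
      ∀ x ∈ E, ∀ y ∈ E, ∀ z ∈ op x y, D ≤ rank z + k → z ∈ E := by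
    intro k
    induction k with
    | zero =>
      refine ⟨F, subset_rfl, hF, hD, fun x _ y hy z hz h => ?_⟩
      have := hD y hy
      have := (hrank x y z hz).1
      omega
    | succ k ih =>
      obtain ⟨E, hFE, hE, hED, hcl⟩ := ih
      refine ⟨E ∪ ⋃ x ∈ E, ⋃ y ∈ E, op x y, hFE.trans Set.subset_union_left,
        hE.union (hE.biUnion fun x _ => hE.biUnion fun y _ => hop x y), ?_, ?_⟩
      · rintro z (hz | hz)
        · exact hED z hz
        · simp only [Set.mem_iUnion] at hz
          obtain ⟨x, hx, y, hy, hz⟩ := hz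
          exact (hrank x y z hz).1.trans (hED y hy)
      · have hold : ∀ x ∈ E ∪ ⋃ x ∈ E, ⋃ y ∈ E, op x y, D ≤ rank x + k → x ∈ E := by
          rintro z (hz | hz) hk
          · exact hz
          · simp only [Set.mem_iUnion] at hz
            obtain ⟨x, hx, y, hy, hz⟩ := hz
            exact hcl x hx y hy z hz hk
        intro x hx y hy z hz hk
        have h1 := hrank x y z hz
        refine Or.inr ?_
        simp only [Set.mem_iUnion]
        exact ⟨x, hold x hx (by omega), y, hold y hy (by omega), hz⟩
  obtain ⟨E, hFE, hE, -, hcl⟩ := key D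
  exact ⟨E, hFE, hE, fun x hx y hy z hz => hcl x hx y hy z hz (by omega)⟩

lemma sign_eq_of_forall_ne_zero {f : ℝ → ℝ} (hf : Continuous f) {a b : ℝ}
    (h : ∀ s ∈ Set.uIcc a b, f s ≠ 0) : SignType.sign (f a) = SignType.sign (f b) := by
  have hiv := intermediate_value_uIcc (hf.continuousOn (s := Set.uIcc a b))
  have h0 : (0 : ℝ) ∉ Set.uIcc (f a) (f b) := fun h0 => by
    obtain ⟨s, hs, hs0⟩ := hiv h0
    exact h s hs hs0
  have ha := h a Set.left_mem_uIcc
  have hb := h b Set.right_mem_uIcc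
  rw [Set.mem_uIcc] at h0
  rcases ha.lt_or_gt with ha | ha <;> rcases hb.lt_or_gt with hb | hb
  · rw [sign_neg ha, sign_neg hb]
  · exact absurd (Or.inl ⟨ha.le, hb.le⟩) h0
  · exact absurd (Or.inr ⟨hb.le, ha.le⟩) h0
  · rw [sign_pos ha, sign_pos hb]

/-- The roots of those specializations of members of `E` that are not identically zero. -/
def rootsOfFamily (E : Set A[X]) (φ : A →+* ℝ) : Set ℝ :=
  {t | ∃ f ∈ E, f.map φ ≠ 0 ∧ (f.map φ).eval t = 0}

lemma isClosed_rootsOfFamily {E : Set A[X]} (hE : E.Finite) (φ : A →+* ℝ) :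
    IsClosed (rootsOfFamily E φ) := by
  have : rootsOfFamily E φ = ⋃ f ∈ E, {t | f.map φ ≠ 0 ∧ (f.map φ).eval t = 0} := by
    ext t
    simp only [rootsOfFamily, Set.mem_ofPred_eq, Set.mem_iUnion, exists_prop]
  rw [this]
  exact hE.isClosed_biUnion fun f _ =>
    isClosed_const.and (isClosed_eq (f.map φ).continuous continuous_const)

lemma SameSigns.of_forall_notMem_rootsOfFamily {E : Set A[X]} {φ : A →+* ℝ} {t t' : ℝ}
    (h : ∀ s ∈ Set.uIcc t t', s ∉ rootsOfFamily E φ) : SameSigns E φ φ t t' := by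
  intro f hf
  by_cases h0 : f.map φ = 0
  · simp [h0]
  · exact sign_eq_of_forall_ne_zero (f.map φ).continuous fun s hs hs0 => h s hs ⟨f, hf, h0, hs0⟩

lemma map_eq_zero_of_sameSigns {E : Set A[X]} {φ ψ : A →+* ℝ}
    (h : ∀ u, ∃ t, SameSigns E φ ψ t u) {f : A[X]} (hf : f ∈ E) (h0 : f.map φ = 0) :
    f.map ψ = 0 := by
  refine Polynomial.funext fun u => ?_
  obtain ⟨t, ht⟩ := h u
  have := ht f hf
  rw [h0, eval_zero, sign_zero] at this
  rw [eval_zero]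
  exact sign_eq_zero_iff.1 this.symm

lemma map_eraseLead_of_leadingCoeff_eq_zero {φ : A →+* ℝ} {f : A[X]}
    (h : φ f.leadingCoeff = 0) : f.eraseLead.map φ = f.map φ := by
  have := congrArg (Polynomial.map φ) f.eraseLead_add_C_mul_X_pow
  simpa [-eraseLead_add_C_mul_X_pow, h] using this

lemma EliminationClosed.derivativeClosed {E : Set A[X]} (hE : EliminationClosed E) :
    DerivativeClosed E :=
  fun f hf h0 => hE f hf f hf ⟨h0, le_rfl, Or.inl rfl⟩

lemma EliminationClosed.eraseLead_mem {E : Set A[X]} (hE : EliminationClosed E) {f : A[X]}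
    (hf : f ∈ E) (h0 : f.natDegree ≠ 0) : f.eraseLead ∈ E :=
  hE f hf f hf ⟨h0, le_rfl, Or.inr (Or.inl rfl)⟩

lemma EliminationClosed.leadingCoeff_mem {E : Set A[X]} (hE : EliminationClosed E) {f : A[X]}
    (hf : f ∈ E) (h0 : f.natDegree ≠ 0) : C f.leadingCoeff ∈ E :=
  hE f hf f hf ⟨h0, le_rfl, Or.inr (Or.inr (Or.inl rfl))⟩

/-- A marked point is a root of a member whose leading coefficient does not vanish. -/
lemma EliminationClosed.exists_leadingCoeff_ne_zero {E : Set A[X]} (hE : EliminationClosed E)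
    {φ : A →+* ℝ} {t : ℝ} (ht : t ∈ rootsOfFamily E φ) :
    ∃ f ∈ E, f.natDegree ≠ 0 ∧ φ f.leadingCoeff ≠ 0 ∧ (f.map φ).eval t = 0 := by
  obtain ⟨f, hf, h0, hft⟩ := ht
  suffices H : ∀ n, ∀ f ∈ E, f.natDegree = n → f.map φ ≠ 0 → (f.map φ).eval t = 0 →
      ∃ f ∈ E, f.natDegree ≠ 0 ∧ φ f.leadingCoeff ≠ 0 ∧ (f.map φ).eval t = 0 from
    H _ f hf rfl h0 hft
  clear f hf h0 hft
  intro n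
  induction n using Nat.strong_induction_on with
  | _ n ih =>
  intro f hf hn h0 hft
  have hdeg : f.natDegree ≠ 0 := by
    intro hdeg
    rw [eq_C_of_natDegree_eq_zero hdeg, map_C] at h0 hft
    rw [eval_C] at hft
    rw [hft, C_0] at h0
    exact h0 rfl
  by_cases hlc : φ f.leadingCoeff = 0
  · have he := map_eraseLead_of_leadingCoeff_eq_zero hlc
    exact ih _ (by have := eraseLead_natDegree_le f; omega) _ (hE.eraseLead_mem hf hdeg) rfl
      (he ▸ h0) (he ▸ hft)
  · exact ⟨f, hf, hdeg, hlc, hft⟩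

/-- At corresponding marked points, the signs of `p` are those of a pseudo-remainder. -/
lemma sign_eval_eq_of_mem_rootsOfFamily {E : Set A[X]} (hE : EliminationClosed E)
    {φ ψ : A →+* ℝ} {p : A[X]} (hp : ∀ f ∈ E, f.natDegree ≠ 0 → pseudoRem p f ∈ E) {t u : ℝ}
    (h : SameSigns E φ ψ t u) (ht : t ∈ rootsOfFamily E φ) :
    SignType.sign ((p.map φ).eval t) = SignType.sign ((p.map ψ).eval u) := by
  obtain ⟨f, hf, hdeg, hlc, hft⟩ := hE.exists_leadingCoeff_ne_zero ht
  have hfu : (f.map ψ).eval u = 0 := by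
    have := h f hf
    rw [hft, sign_zero] at this
    exact sign_eq_zero_iff.1 this.symm
  have hs : SignType.sign (φ f.leadingCoeff) = SignType.sign (ψ f.leadingCoeff) := by
    simpa using h _ (hE.leadingCoeff_mem hf hdeg)
  obtain ⟨q, k, -, he⟩ := pseudoRem_spec p hdeg
  have key : ∀ (χ : A →+* ℝ) (x : ℝ), (f.map χ).eval x = 0 →
      SignType.sign (χ f.leadingCoeff) ^ k * SignType.sign ((p.map χ).eval x) =
        SignType.sign (((pseudoRem p f).map χ).eval x) := by
    intro χ x hx
    have h1 := congrArg (fun g => (g.map χ).eval x) he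
    simp only [Polynomial.map_mul, Polynomial.map_pow, map_C, Polynomial.map_add, eval_mul,
      eval_pow, eval_C, eval_add, hx, mul_zero, zero_add] at h1
    rw [← h1, sign_mul, sign_pow]
  have h1 := key φ t hft
  have h2 := key ψ u hfu
  rw [h _ (hp f hf hdeg), ← h2, ← hs] at h1
  exact mul_left_cancel₀ (pow_ne_zero k (by rwa [Ne, sign_eq_zero_iff])) h1

/-- If the constant members of a family closed under elimination have the same signs after
specialization by `φ` and by `ψ`, then the two specialized families realize the same
sign vectors. -/
theorem EliminationClosed.exists_sameSigns (s : Finset A[X]) :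
    EliminationClosed (s : Set A[X]) → ∀ φ ψ : A →+* ℝ,
      (∀ c, C c ∈ s → SignType.sign (φ c) = SignType.sign (ψ c)) →
      ∀ t, ∃ u, SameSigns (s : Set A[X]) φ ψ t u := by
  classical
  induction s using Finset.induction_on_max_value (fun f : A[X] => f.natDegree) with
  | empty => exact fun _ _ _ _ t => ⟨t, fun f hf => absurd hf (by simp)⟩
  | insert p s hps hmax ih =>
  intro hcl φ ψ hsign t
  rw [Finset.coe_insert] at hcl
  have hmem : ∀ {g}, g ∈ insert p (s : Set A[X]) → g.natDegree < p.natDegree → g ∈ s :=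
    fun {g} hg hlt => by
      rcases hg with rfl | hg
      · exact absurd hlt (lt_irrefl _)
      · exact hg
  have hscl : EliminationClosed (s : Set A[X]) := fun f hf g hg x hx =>
    hmem (hcl f (Or.inr hf) g (Or.inr hg) hx)
      ((natDegree_lt_of_mem_eliminants hx).1.trans_le (hmax g hg))
  have hsign' : ∀ c, C c ∈ s → SignType.sign (φ c) = SignType.sign (ψ c) :=
    fun c hc => hsign c (Finset.mem_insert_of_mem hc)
  have hright := ih hscl φ ψ hsign'
  suffices H : ∃ u, SameSigns (s : Set A[X]) φ ψ t u ∧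
      SignType.sign ((p.map φ).eval t) = SignType.sign ((p.map ψ).eval u) by
    obtain ⟨u, hu, hpu⟩ := H
    refine ⟨u, fun f hf => ?_⟩
    rcases Finset.mem_insert.1 (Finset.mem_coe.1 hf) with rfl | hf
    · exact hpu
    · exact hu f hf
  by_cases hdeg : p.natDegree = 0
  · obtain ⟨u, hu⟩ := hright t
    refine ⟨u, hu, ?_⟩
    rw [eq_C_of_natDegree_eq_zero hdeg]
    simp only [map_C, eval_C]
    exact hsign _ (by rw [← eq_C_of_natDegree_eq_zero hdeg]; exact Finset.mem_insert_self _ _)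
  have hpp : ∀ {g}, g ∈ eliminants p p → g ∈ s := fun {g} hg =>
    hmem (hcl p (Or.inl rfl) p (Or.inl rfl) hg) (natDegree_lt_of_mem_eliminants hg).1
  have hder : derivative p ∈ s := hpp ⟨hdeg, le_rfl, Or.inl rfl⟩
  have herase : p.eraseLead ∈ s := hpp ⟨hdeg, le_rfl, Or.inr (Or.inl rfl)⟩
  have hlcs : C p.leadingCoeff ∈ s := hpp ⟨hdeg, le_rfl, Or.inr (Or.inr (Or.inl rfl))⟩
  have hlc := hsign' _ hlcs
  by_cases hφ : φ p.leadingCoeff = 0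
  · have hψ : ψ p.leadingCoeff = 0 := by
      rw [hφ, sign_zero] at hlc
      exact sign_eq_zero_iff.1 hlc.symm
    obtain ⟨u, hu⟩ := hright t
    refine ⟨u, hu, ?_⟩
    rw [← map_eraseLead_of_leadingCoeff_eq_zero hφ, ← map_eraseLead_of_leadingCoeff_eq_zero hψ]
    exact hu _ herase
  have hψ : ψ p.leadingCoeff ≠ 0 := fun hψ => hφ <| by
    rw [hψ, sign_zero] at hlc
    exact sign_eq_zero_iff.1 hlc
  have hleft : ∀ u, ∃ t, SameSigns (s : Set A[X]) φ ψ t u := fun u => by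
    obtain ⟨t, ht⟩ := ih hscl ψ φ (fun c hc => (hsign' c hc).symm) u
    exact ⟨t, ht.symm⟩
  have hsigneq : ∀ {t u}, SameSigns (s : Set A[X]) φ ψ t u → t ∈ rootsOfFamily (s : Set A[X]) φ →
      SignType.sign ((p.map φ).eval t) = SignType.sign ((p.map ψ).eval u) := fun {t u} hR ht =>
    sign_eval_eq_of_mem_rootsOfFamily hscl (fun f hf h0 =>
      have hx : pseudoRem p f ∈ eliminants p f :=
        ⟨h0, hmax f hf, Or.inr (Or.inr (Or.inr rfl))⟩
      hmem (hcl p (Or.inl rfl) f (Or.inr hf) hx) (natDegree_lt_of_mem_eliminants hx).2) hR ht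
  have hcorr : SignCorrespondence (p.map φ) (p.map ψ) (rootsOfFamily (s : Set A[X]) φ)
      (rootsOfFamily (s : Set A[X]) ψ) (SameSigns (s : Set A[X]) φ ψ) :=
    { isClosed_left := isClosed_rootsOfFamily s.finite_toSet φ
      isClosed_right := isClosed_rootsOfFamily s.finite_toSet ψ
      exists_right := hright
      exists_left := hleft
      mem_iff := by
        intro t u hR
        refine exists_congr fun f => and_congr_right fun hf => and_congr (not_congr ?_) ?_
        · exact ⟨map_eq_zero_of_sameSigns hleft hf, map_eq_zero_of_sameSigns
            (fun t => (hright t).imp fun _ h => h.symm) hf⟩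
        · rw [← sign_eq_zero_iff, hR f hf, sign_eq_zero_iff]
      order := fun hR hR' htt => hR.lt_or_sameSigns hscl.derivativeClosed hR' htt
      sign_eq := hsigneq
      sign_derivative := fun hR => by
        rw [derivative_map, derivative_map]
        exact hR _ hder
      move_left := fun hR hs => (SameSigns.of_forall_notMem_rootsOfFamily hs).symm.trans hR
      move_right := fun hR hs => hR.trans (SameSigns.of_forall_notMem_rootsOfFamily hs)
      natDegree_ne_zero := by rwa [natDegree_map_of_leadingCoeff_ne_zero ψ hψ] }
  obtain ⟨u, hu⟩ := hright t
  by_cases ht : t ∈ rootsOfFamily (s : Set A[X]) φ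
  · exact ⟨u, hu, hsigneq hu ht⟩
  · refine hcorr.exists_sign_eq hu ht fun h0 => ht ⟨_, hder, fun hz => ?_, ?_⟩
    · rw [← derivative_map] at hz
      have := derivative_eq_zero.1 hz
      rw [natDegree_map_of_leadingCoeff_ne_zero φ hφ] at this
      exact hdeg this
    · rwa [← derivative_map]

end SignTransfer

/-! ### Sets defined by sign conditions on finitely many polynomials -/

section SignDefinable

open MvPolynomial

/-- Membership in `Z` is determined by the signs of finitely many polynomials. -/
def IsSignDefinable {σ : Type*} (Z : Set (σ → ℝ)) : Prop :=
  ∃ G : Set (MvPolynomial σ ℝ), G.Finite ∧ ∀ x y : σ → ℝ,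
    (∀ g ∈ G, SignType.sign (eval x g) = SignType.sign (eval y g)) → x ∈ Z → y ∈ Z

namespace IsSignDefinable

variable {σ τ : Type*} {Z W : Set (σ → ℝ)}

lemma compl (h : IsSignDefinable Z) : IsSignDefinable Zᶜ := by
  obtain ⟨G, hG, h⟩ := h
  exact ⟨G, hG, fun x y hxy hx hy => hx (h y x (fun g hg => (hxy g hg).symm) hy)⟩

lemma iInter {ι : Type*} [Finite ι] {Z : ι → Set (σ → ℝ)} (h : ∀ i, IsSignDefinable (Z i)) :
    IsSignDefinable (⋂ i, Z i) := by
  choose G hG h using h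
  refine ⟨⋃ i, G i, Set.finite_iUnion hG, fun x y hxy hx => Set.mem_iInter.2 fun i => ?_⟩
  exact h i x y (fun g hg => hxy g (Set.mem_iUnion_of_mem i hg)) (Set.mem_iInter.1 hx i)

lemma iUnion {ι : Type*} [Finite ι] {Z : ι → Set (σ → ℝ)} (h : ∀ i, IsSignDefinable (Z i)) :
    IsSignDefinable (⋃ i, Z i) := by
  rw [← compl_compl (⋃ i, Z i), Set.compl_iUnion]
  exact (iInter fun i => (h i).compl).compl

lemma inter (hZ : IsSignDefinable Z) (hW : IsSignDefinable W) : IsSignDefinable (Z ∩ W) := by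
  rw [Set.inter_eq_iInter]
  exact iInter fun b => by cases b <;> assumption

lemma union (hZ : IsSignDefinable Z) (hW : IsSignDefinable W) : IsSignDefinable (Z ∪ W) := by
  rw [Set.union_eq_iUnion]
  exact iUnion fun b => by cases b <;> assumption

lemma setOf_eval_eq_zero (p : MvPolynomial σ ℝ) : IsSignDefinable {x | eval x p = 0} := by
  refine ⟨{p}, Set.finite_singleton p, fun x y hxy hx => ?_⟩
  have := hxy p rfl
  rw [show eval x p = 0 from hx, sign_zero] at this
  exact sign_eq_zero_iff.1 this.symm

lemma setOf_eval_pos (p : MvPolynomial σ ℝ) : IsSignDefinable {x | 0 < eval x p} := by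
  refine ⟨{p}, Set.finite_singleton p, fun x y hxy hx => ?_⟩
  have := hxy p rfl
  rw [sign_pos hx] at this
  exact sign_eq_one_iff.1 this.symm

/-- Preimages under polynomial maps. -/
lemma preimage {Z : Set (τ → ℝ)} (h : IsSignDefinable Z) (F : τ → MvPolynomial σ ℝ) :
    IsSignDefinable {x : σ → ℝ | (fun j => eval x (F j)) ∈ Z} := by
  obtain ⟨G, hG, h⟩ := h
  have key : ∀ (x : σ → ℝ) (g : MvPolynomial τ ℝ),
      eval x (bind₁ F g) = eval (fun j => eval x (F j)) g := fun x g => by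
    rw [← coe_aeval_eq_eval, RingHom.coe_coe, aeval_bind₁, ← coe_aeval_eq_eval]
    rfl
  refine ⟨bind₁ F '' G, hG.image _, fun x y hxy hx => h _ _ (fun g hg => ?_) hx⟩
  rw [← key, ← key]
  exact hxy _ ⟨g, hg, rfl⟩

lemma preimage_comp {Z : Set (τ → ℝ)} (h : IsSignDefinable Z) (e : τ → σ) :
    IsSignDefinable {x : σ → ℝ | x ∘ e ∈ Z} := by
  simpa [Function.comp_def] using h.preimage fun j => X (e j)

/-- The Tarski–Seidenberg theorem, for the projection forgetting one coordinate. -/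
lemma exists_option {Z : Set (Option σ → ℝ)} (h : IsSignDefinable Z) :
    IsSignDefinable {x : σ → ℝ | ∃ t : ℝ, (fun o : Option σ => o.elim t x) ∈ Z} := by
  obtain ⟨G, hG, h⟩ := h
  obtain ⟨E, hGE, hE, hcl⟩ := (hG.image (optionEquivLeft ℝ σ)).exists_finite_closed_superset
    Polynomial.natDegree eliminants finite_eliminants
    fun _ _ _ hz => natDegree_lt_of_mem_eliminants hz
  refine ⟨Polynomial.C ⁻¹' E, hE.preimage Polynomial.C_injective.injOn, ?_⟩
  rintro x y hxy ⟨t, ht⟩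
  have hcl' : EliminationClosed ((hE.toFinset : Finset _) : Set (Polynomial (MvPolynomial σ ℝ))) :=
    by rwa [hE.coe_toFinset]
  obtain ⟨u, hu⟩ := hcl'.exists_sameSigns _ (eval x) (eval y)
    (fun c hc => hxy c (hE.mem_toFinset.1 hc)) t
  refine ⟨u, h _ _ (fun g hg => ?_) ht⟩
  have := hu _ (by rw [hE.coe_toFinset]; exact hGE ⟨g, hg, rfl⟩)
  rwa [← optionEquivLeft_elim_eval, ← optionEquivLeft_elim_eval] at this

lemma exists_fin {n : ℕ} : ∀ {σ : Type*} {Z : Set (σ ⊕ Fin n → ℝ)}, IsSignDefinable Z →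
    IsSignDefinable {x : σ → ℝ | ∃ y : Fin n → ℝ, Sum.elim x y ∈ Z} := by
  induction n with
  | zero =>
    intro σ Z h
    convert h.preimage_comp (σ := σ) (Sum.elim id Fin.elim0) using 1
    ext x
    have : ∀ y : Fin 0 → ℝ, Sum.elim x y = x ∘ Sum.elim id Fin.elim0 := fun y => by
      ext (i | i)
      · rfl
      · exact i.elim0
    simp only [Set.mem_ofPred_eq, this, exists_const]
  | succ n ih =>
    intro σ Z h
    have h1 := (ih (h.preimage_comp (σ := Option σ ⊕ Fin n)
      (Sum.elim (fun i => Sum.inl (some i)) (Fin.cons (Sum.inl none) Sum.inr)))).exists_option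
    convert h1 using 1
    ext x
    have key : ∀ (t : ℝ) (y : Fin n → ℝ),
        (Sum.elim (fun o : Option σ => o.elim t x) y ∘
          Sum.elim (fun i => Sum.inl (some i)) (Fin.cons (Sum.inl none) Sum.inr) :
            σ ⊕ Fin (n + 1) → ℝ) = Sum.elim x (Fin.cons t y) := by
      intro t y
      ext (i | i)
      · rfl
      · refine Fin.cases ?_ (fun i => ?_) i <;> rfl
    simp only [Set.mem_ofPred_eq, key]
    exact ⟨fun ⟨y, hy⟩ => ⟨y 0, Fin.tail y, by rwa [Fin.cons_self_tail]⟩,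
      fun ⟨t, y, hy⟩ => ⟨_, hy⟩⟩

/-- The Tarski–Seidenberg theorem: projections preserve sign definability. -/
lemma exists_sum [Finite τ] {Z : Set (σ ⊕ τ → ℝ)} (h : IsSignDefinable Z) :
    IsSignDefinable {x : σ → ℝ | ∃ y : τ → ℝ, Sum.elim x y ∈ Z} := by
  obtain ⟨n, ⟨e⟩⟩ := Finite.exists_equiv_fin τ
  convert (h.preimage_comp (Sum.map id e : σ ⊕ τ → σ ⊕ Fin n)).exists_fin using 1
  ext x
  have key : ∀ y : Fin n → ℝ, Sum.elim x y ∘ Sum.map id e = Sum.elim x (y ∘ e) := fun y => by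
    ext (i | i) <;> rfl
  simp only [Set.mem_ofPred_eq, key]
  exact ⟨fun ⟨y, hy⟩ => ⟨y ∘ e.symm, by simpa [Function.comp_assoc] using hy⟩,
    fun ⟨y, hy⟩ => ⟨_, hy⟩⟩

lemma forall_sum [Finite τ] {Z : Set (σ ⊕ τ → ℝ)} (h : IsSignDefinable Z) :
    IsSignDefinable {x : σ → ℝ | ∀ y : τ → ℝ, Sum.elim x y ∈ Z} := by
  convert h.compl.exists_sum.compl using 1
  ext x
  simp

lemma setOf_lt (i j : σ) : IsSignDefinable {x : σ → ℝ | x i < x j} := by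
  convert setOf_eval_pos (X j - X i : MvPolynomial σ ℝ) using 1
  ext x
  simp

lemma setOf_eq (i j : σ) : IsSignDefinable {x : σ → ℝ | x i = x j} := by
  convert setOf_eval_eq_zero (X i - X j : MvPolynomial σ ℝ) using 1
  ext x
  simp [sub_eq_zero]

lemma nonempty_interior_iff_exists_box [Fintype τ] (S : Set (τ → ℝ)) :
    (interior S).Nonempty ↔ ∃ z : τ ⊕ τ → ℝ, (∀ i, z (.inl i) < z (.inr i)) ∧
      ∀ y : τ → ℝ, (∀ i, z (.inl i) < y i ∧ y i < z (.inr i)) → y ∈ S := by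
  constructor
  · rintro ⟨x, hx⟩
    obtain ⟨ε, hε, hball⟩ := Metric.isOpen_iff.1 isOpen_interior x hx
    refine ⟨Sum.elim (fun i => x i - ε) (fun i => x i + ε), fun i => ?_, fun y hy => ?_⟩
    · simp only [Sum.elim_inl, Sum.elim_inr]
      linarith
    · refine interior_subset (hball ?_)
      rw [Metric.mem_ball, dist_pi_lt_iff hε]
      intro i
      have := hy i
      simp only [Sum.elim_inl, Sum.elim_inr] at this
      rw [Real.dist_eq, abs_lt]
      constructor <;> linarith
  · rintro ⟨z, hz, hS⟩
    refine ⟨fun i => (z (.inl i) + z (.inr i)) / 2, ?_⟩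
    have hopen : IsOpen (Set.univ.pi fun i => Set.Ioo (z (.inl i)) (z (.inr i))) :=
      isOpen_set_pi Set.finite_univ fun i _ => isOpen_Ioo
    refine interior_maximal (fun y (hy : y ∈ Set.univ.pi _) => hS y fun i => hy i trivial) hopen fun i _ => ?_
    have := hz i
    constructor <;> linarith

/-- Having a fibre with nonempty interior is a sign definable condition. -/
lemma setOf_nonempty_interior_fiber [Fintype τ] {W : Set (σ ⊕ τ → ℝ)} (h : IsSignDefinable W) :
    IsSignDefinable {x : σ → ℝ | (interior {y : τ → ℝ | Sum.elim x y ∈ W}).Nonempty} := by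
  have h1 : IsSignDefinable {v : σ ⊕ (τ ⊕ τ) → ℝ | ∀ i, v (.inr (.inl i)) < v (.inr (.inr i))} := by
    rw [Set.ofPred_forall]
    exact iInter fun i => setOf_lt _ _
  have h2 : IsSignDefinable {v : (σ ⊕ (τ ⊕ τ)) ⊕ τ → ℝ |
      ∀ i, v (.inl (.inr (.inl i))) < v (.inr i) ∧ v (.inr i) < v (.inl (.inr (.inr i)))} := by
    rw [Set.ofPred_forall]
    exact iInter fun i => (setOf_lt _ _).inter (setOf_lt _ _)
  have h3 := h.preimage_comp
    (Sum.map Sum.inl id : σ ⊕ τ → (σ ⊕ (τ ⊕ τ)) ⊕ τ)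
  convert (h1.inter (h2.compl.union h3).forall_sum).exists_sum using 1
  ext x
  have key : ∀ (z : τ ⊕ τ → ℝ) (y : τ → ℝ),
      Sum.elim (Sum.elim x z) y ∘ Sum.map Sum.inl id = Sum.elim x y := fun z y => by
    ext (i | i) <;> rfl
  simp only [Set.mem_ofPred_eq, nonempty_interior_iff_exists_box, Set.mem_inter_iff,
    Set.mem_union, Set.mem_compl_iff, Sum.elim_inl, Sum.elim_inr, key, imp_iff_not_or]

/-- A sign definable set with empty interior is contained in the zero set of a nonzero
polynomial. -/
lemma exists_ne_zero_of_interior_eq_empty [Finite σ] (h : IsSignDefinable Z)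
    (hZ : ¬ (interior Z).Nonempty) : ∃ g : MvPolynomial σ ℝ, g ≠ 0 ∧ ∀ x ∈ Z, eval x g = 0 := by
  classical
  obtain ⟨G, hG, h⟩ := h
  refine ⟨∏ g ∈ hG.toFinset with g ≠ 0, g, ?_, fun x hx => ?_⟩
  · rw [Finset.prod_ne_zero_iff]
    exact fun g hg => (Finset.mem_filter.1 hg).2
  · by_contra hne
    rw [← Ne, map_prod, Finset.prod_ne_zero_iff] at hne
    refine hZ ⟨x, mem_interior_iff_mem_nhds.2 ?_⟩
    have hev : ∀ᶠ y in nhds x, ∀ g ∈ G, SignType.sign (eval x g) = SignType.sign (eval y g) := by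
      refine (Filter.eventually_all_finite hG).2 fun g hg => ?_
      by_cases h0 : g = 0
      · simp [h0]
      have hgx : eval x g ≠ 0 := hne g (by simp [hg, h0])
      have hc : ContinuousAt (fun y => eval y g) x := (MvPolynomial.continuous_eval g).continuousAt
      rcases hgx.lt_or_gt with hlt | hgt
      · filter_upwards [hc.eventually (gt_mem_nhds hlt)] with y hy
        rw [sign_neg hlt, sign_neg hy]
      · filter_upwards [hc.eventually (lt_mem_nhds hgt)] with y hy
        rw [sign_pos hgt, sign_pos hy]
    filter_upwards [hev] with y hy
    exact h x y hy hx

lemma isSemialgebraic {a : ℕ} {Z : Set (Fin a → ℝ)} (h : IsSignDefinable Z) :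
    IsSemialgebraic a Z := by
  classical
  obtain ⟨G, hG, h⟩ := h
  have := hG.fintype
  set T := {s : G → SignType // ∃ x ∈ Z, ∀ g : G, SignType.sign (eval x g.1) = s g} with hT
  let e : Fin (Fintype.card T) ≃ T := (Fintype.equivFin T).symm
  let c : Fin (Fintype.card G) ≃ G := (Fintype.equivFin G).symm
  refine ⟨Fintype.card T, fun _ => Fintype.card G, fun _ => Fintype.card G,
    fun i j => if (e i).1 (c j) = 0 then (c j).1 else 0,
    fun i j => if (e i).1 (c j) = 0 then 1 else
      if (e i).1 (c j) = 1 then (c j).1 else -(c j).1, ?_⟩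
  have key : ∀ (i : Fin (Fintype.card T)) (x : Fin a → ℝ),
      ((∀ j, eval x (if (e i).1 (c j) = 0 then (c j).1 else 0) = 0) ∧
        ∀ j, 0 < eval x (if (e i).1 (c j) = 0 then 1 else
          if (e i).1 (c j) = 1 then (c j).1 else -(c j).1)) ↔
      ∀ g : G, SignType.sign (eval x g.1) = (e i).1 g := by
    intro i x
    rw [← forall_and, c.forall_congr_left]
    refine forall_congr' fun g => ?_
    rw [c.apply_symm_apply]
    cases hs : (e i).1 g
    · simp [sign_eq_zero_iff]
    · simp [sign_eq_neg_one_iff]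
    · simp [sign_eq_one_iff]
  ext x
  simp only [Set.mem_iUnion, Set.mem_ofPred_eq, key]
  constructor
  · intro hx
    refine ⟨e.symm ⟨fun g => SignType.sign (eval x g.1), x, hx, fun _ => rfl⟩, fun g => ?_⟩
    rw [e.apply_symm_apply]
  · rintro ⟨i, hi⟩
    obtain ⟨y, hy, hys⟩ := (e i).2
    exact h y x (fun g hg => (hys ⟨g, hg⟩).trans (hi ⟨g, hg⟩).symm) hy

end IsSignDefinable

end SignDefinable

section Dimension

open MvPolynomial Topology

variable {σ : Type*}

lemma hasStrictFDerivAt_eval [Fintype σ] (p : MvPolynomial σ ℝ) (x : σ → ℝ) :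
    HasStrictFDerivAt (fun y : σ → ℝ => eval y p)
      (∑ i, eval x (pderiv i p) • ContinuousLinearMap.proj (R := ℝ) (φ := fun _ : σ => ℝ) i) x := by
  classical
  induction p using MvPolynomial.induction_on with
  | C a => simpa using hasStrictFDerivAt_const a x
  | add p q hp hq =>
    simp only [map_add, add_smul, Finset.sum_add_distrib]
    exact hp.add hq
  | mul_X p i hp =>
    have hX : HasStrictFDerivAt (fun y : σ → ℝ => y i)
        (ContinuousLinearMap.proj (R := ℝ) (φ := fun _ : σ => ℝ) i) x :=
      (ContinuousLinearMap.proj (R := ℝ) (φ := fun _ : σ => ℝ) i).hasStrictFDerivAt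
    simp only [map_mul, eval_X]
    refine (hp.mul hX).congr_fderiv ?_
    ext v
    simp [pderiv_X, Pi.single_apply, add_mul, Finset.sum_add_distrib,
      Finset.mul_sum, mul_assoc, apply_ite]

lemma pderiv_mem_supported {s : Set σ} {p : MvPolynomial σ ℝ} (hp : p ∈ supported ℝ s) (j : σ) :
    pderiv j p ∈ supported ℝ s := by
  rw [mem_supported] at hp ⊢
  intro i hi
  obtain ⟨d, hd, hid⟩ := (mem_vars_iff_mem_support i).1 hi
  refine hp ((mem_vars_iff_mem_support i).2 ⟨d + Finsupp.single j 1, ?_, ?_⟩)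
  · rw [mem_support_iff, coeff_pderiv] at hd
    exact mem_support_iff.2 (left_ne_zero_of_mul hd)
  · rw [Finsupp.mem_support_iff] at hid ⊢
    simp [hid]

lemma degreeOf_pderiv_lt {j : σ} {p : MvPolynomial σ ℝ} (hj : j ∈ p.vars) :
    degreeOf j (pderiv j p) < degreeOf j p := by
  rw [degreeOf_lt_iff (Nat.pos_of_ne_zero (mem_vars_iff_degreeOf_ne_zero.1 hj))]
  intro d hd
  rw [mem_support_iff, coeff_pderiv] at hd
  have := monomial_le_degreeOf j (mem_support_iff.2 (left_ne_zero_of_mul hd))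
  simp at this
  omega

lemma pderiv_ne_zero {j : σ} {p : MvPolynomial σ ℝ} (hj : j ∈ p.vars) : pderiv j p ≠ 0 := by
  obtain ⟨d, hd, hid⟩ := (mem_vars_iff_mem_support j).1 hj
  rw [Finsupp.mem_support_iff] at hid
  intro h
  have := coeff_pderiv (i := j) p (d - Finsupp.single j 1)
  rw [h, tsub_add_cancel_of_le (by simpa [Nat.one_le_iff_ne_zero] using hid)] at this
  rw [coeff_zero, eq_comm, mul_eq_zero] at this
  rcases this with h | h
  · exact mem_support_iff.1 hd h
  · exact absurd h (by positivity)

/-- If no nonzero element of `J` involves only the variables in `s`, then a nonzero element of `J`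
in the variables `insert j s` can be differentiated until its `j`-derivative leaves `J`. -/
lemma exists_pderiv_notMem {J : Ideal (MvPolynomial σ ℝ)} {s : Set σ}
    (hs : ∀ p ∈ J, p ∈ supported ℝ s → p = 0) (j : σ) {p : MvPolynomial σ ℝ} (hpJ : p ∈ J)
    (hp : p ≠ 0) (hps : p ∈ supported ℝ (insert j s)) :
    ∃ q ∈ J, q ∈ supported ℝ (insert j s) ∧ pderiv j q ∉ J := by
  induction h : degreeOf j p using Nat.strong_induction_on generalizing p with
  | _ n ih =>
    by_cases hJ : pderiv j p ∈ J
    · have hj : j ∈ p.vars := by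
        by_contra hj
        refine hp (hs p hpJ (mem_supported.2 fun i hi => ?_))
        exact (mem_supported.1 hps hi).resolve_left fun hij => hj (hij ▸ hi)
      exact ih _ (h ▸ degreeOf_pderiv_lt hj) hJ (pderiv_ne_zero hj)
        (pderiv_mem_supported hps j) rfl
    · exact ⟨p, hpJ, hps, hJ⟩

lemma HasStrictFDerivAt.exists_antilipschitzWith {E F : Type*} [NormedAddCommGroup E]
    [NormedSpace ℝ E] [NormedAddCommGroup F] [NormedSpace ℝ F] {f : E → F} {f' : E ≃L[ℝ] F}
    {x : E} (hf : HasStrictFDerivAt f (f' : E →L[ℝ] F) x) :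
    ∃ U ∈ 𝓝 x, ∃ K, AntilipschitzWith K (U.domRestrict f) := by
  rcases subsingleton_or_nontrivial E with hE | hE
  · exact ⟨Set.univ, Filter.univ_mem, 0, AntilipschitzWith.of_subsingleton⟩
  · have hN : 0 < ‖(f'.symm : F →L[ℝ] E)‖₊⁻¹ := inv_pos.2 f'.nnnorm_symm_pos
    obtain ⟨U, hU, h⟩ := hf.approximates_deriv_on_nhds (Or.inr (half_pos hN))
    exact ⟨U, hU, _, h.antilipschitz (Or.inr (NNReal.half_lt_self hN.ne'))⟩

lemma dimH_le_card_of_forall_notMem_eq_zero [Fintype σ] (I : Finset σ) :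
    dimH {y : σ → ℝ | ∀ j ∉ I, y j = 0} ≤ I.card := by
  classical
  let L : (I → ℝ) →ₗ[ℝ] (σ → ℝ) :=
    LinearMap.pi fun j => if h : j ∈ I then LinearMap.proj ⟨j, h⟩ else 0
  have hL : {y : σ → ℝ | ∀ j ∉ I, y j = 0} ⊆ Set.range L := by
    intro y hy
    refine ⟨fun j => y j, ?_⟩
    ext j
    by_cases hj : j ∈ I
    · simp [L, hj]
    · simp [L, hj, hy j hj]
  calc dimH {y : σ → ℝ | ∀ j ∉ I, y j = 0} ≤ dimH (Set.range L) := dimH_mono hL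
    _ ≤ dimH (Set.univ : Set (I → ℝ)) :=
      (LinearMap.toContinuousLinearMap L).lipschitz.dimH_range_le
    _ = I.card := by rw [Real.dimH_univ_pi]; simp

/-- Near a point where the diagonal derivatives `pderiv j (f j)` do not vanish, the common zero
set of a triangular system has dimension at most the number of free variables. -/
lemma exists_mem_nhds_dimH_le [Fintype σ] {S : Set (σ → ℝ)} {I : Finset σ}
    {f : σ → MvPolynomial σ ℝ} (hf : ∀ j ∉ I, ∀ x ∈ S, eval x (f j) = 0)
    (hfI : ∀ j ∉ I, f j ∈ supported ℝ (insert j (I : Set σ))) {x : σ → ℝ}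
    (hx : ∀ j ∉ I, eval x (pderiv j (f j)) ≠ 0) :
    ∃ U ∈ 𝓝 x, dimH (S ∩ U) ≤ I.card := by
  classical
  let F : σ → MvPolynomial σ ℝ := fun i => if i ∈ I then X i else f i
  let D : (σ → ℝ) →L[ℝ] (σ → ℝ) := ContinuousLinearMap.pi fun j =>
    ∑ i, eval x (pderiv i (F j)) • ContinuousLinearMap.proj (R := ℝ) (φ := fun _ : σ => ℝ) i
  have hD : HasStrictFDerivAt (fun y j => eval y (F j)) D x :=
    hasStrictFDerivAt_pi.2 fun j => hasStrictFDerivAt_eval (F j) x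
  have hinj : Function.Injective D := by
    rw [injective_iff_map_eq_zero]
    intro v hv
    have hv' (j : σ) : ∑ i, eval x (pderiv i (F j)) * v i = 0 := by
      simpa [D] using congr_fun hv j
    have hvI : ∀ i ∈ I, v i = 0 := by
      intro i hi
      simpa [F, hi, pderiv_X, Pi.single_apply, apply_ite] using hv' i
    ext j
    by_cases hj : j ∈ I
    · exact hvI j hj
    · have := hv' j
      rw [Finset.sum_eq_single j] at this
      · simp only [F, hj, if_false] at this
        exact (mul_eq_zero.1 this).resolve_left (hx j hj)
      · intro i _ hij
        by_cases hi : i ∈ I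
        · rw [hvI i hi, mul_zero]
        · simp only [F, hj, if_false]
          rw [pderiv_eq_zero_of_notMem_vars, map_zero, zero_mul]
          intro hmem
          rcases mem_supported.1 (hfI j hj) hmem with h | h
          exacts [hij h, hi h]
      · simp
  let e : (σ → ℝ) ≃L[ℝ] (σ → ℝ) :=
    (LinearEquiv.ofInjectiveEndo (D : (σ → ℝ) →ₗ[ℝ] (σ → ℝ)) hinj).toContinuousLinearEquiv
  have he : (e : (σ → ℝ) →L[ℝ] (σ → ℝ)) = D := by ext v; rfl
  obtain ⟨U, hU, K, hK⟩ := HasStrictFDerivAt.exists_antilipschitzWith (he ▸ hD)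
  refine ⟨U, hU, ?_⟩
  calc dimH (S ∩ U) = dimH (((↑) : U → σ → ℝ) '' ((↑) ⁻¹' S)) := by
        rw [Subtype.image_preimage_coe, Set.inter_comm]
    _ = dimH (((↑) : U → σ → ℝ) ⁻¹' S) := isometry_subtype_coe.dimH_image _
    _ ≤ dimH (U.domRestrict (fun y j => eval y (F j)) '' ((↑) ⁻¹' S)) := hK.le_dimH_image _
    _ ≤ dimH {y : σ → ℝ | ∀ j ∉ I, y j = 0} := by
        refine dimH_mono ?_
        rintro _ ⟨y, hy, rfl⟩ j hj
        simpa [F, hj] using hf j hj y hy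
    _ ≤ I.card := dimH_le_card_of_forall_notMem_eq_zero I

/-- If every `m + 1` coordinates satisfy a nontrivial relation from the ideal `J`, then the real
zero locus of `J` has dimension at most `m`. -/
lemma dimH_zeroLocus_le [Fintype σ] {m : ℕ} (J : Ideal (MvPolynomial σ ℝ))
    (hJ : ∀ I : Finset σ, I.card = m + 1 → ∃ p ∈ J, p ≠ 0 ∧ p ∈ supported ℝ (I : Set σ)) :
    dimH {x : σ → ℝ | ∀ p ∈ J, eval x p = 0} ≤ m := by
  classical
  induction J using IsNoetherian.induction with
  | hgt J ih =>
  have ih_sup : ∀ q ∉ J, dimH {x : σ → ℝ | (∀ p ∈ J, eval x p = 0) ∧ eval x q = 0} ≤ m := by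
    intro q hq
    have hlt : J < J ⊔ Ideal.span {q} := by
      refine lt_of_le_of_ne le_sup_left fun h => hq ?_
      rw [h]
      exact Ideal.mem_sup_right (Ideal.mem_span_singleton_self q)
    refine le_trans (dimH_mono ?_) (ih _ hlt fun I hI => ?_)
    · rintro x ⟨hxJ, hxq⟩ p hp
      obtain ⟨u, hu, v, hv, rfl⟩ := Submodule.mem_sup.1 hp
      obtain ⟨c, rfl⟩ := Ideal.mem_span_singleton'.1 hv
      simp [hxJ u hu, hxq]
    · obtain ⟨p, hp, h⟩ := hJ I hI
      exact ⟨p, Ideal.mem_sup_left hp, h⟩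
  by_cases htop : J = ⊤
  · have : {x : σ → ℝ | ∀ p ∈ J, eval x p = 0} = ∅ := by
      ext x
      simp only [Set.mem_ofPred_eq, Set.mem_empty_iff_false, iff_false]
      intro h
      simpa using h 1 (htop ▸ Submodule.mem_top)
    simp [this]
  by_cases hprime : Ideal.IsPrime J
  · obtain ⟨I, hI, hmax⟩ := Set.Finite.exists_maximal
      (s := {I : Finset σ | ∀ p ∈ J, p ∈ supported ℝ (I : Set σ) → p = 0}) (Set.toFinite _)
      ⟨∅, by
        intro p hp hps
        rw [Finset.coe_empty, supported_empty, Algebra.mem_bot] at hps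
        obtain ⟨c, rfl⟩ := hps
        by_contra hc
        refine htop (Ideal.eq_top_of_isUnit_mem J hp ?_)
        rw [algebraMap_eq] at hc ⊢
        exact (isUnit_iff_ne_zero.2 fun h => hc (by simp [h])).map C⟩
    have hcard : I.card ≤ m := by
      by_contra! hlt
      obtain ⟨I', hI', hI'card⟩ := Finset.exists_subset_card_eq (Nat.succ_le_of_lt hlt)
      obtain ⟨p, hp, hp0, hps⟩ := hJ I' hI'card
      exact hp0 (hI p hp (supported_mono (by exact_mod_cast hI') hps))
    have hex : ∀ j, ∃ q, j ∉ I →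
        q ∈ J ∧ q ∈ supported ℝ (insert j (I : Set σ)) ∧ pderiv j q ∉ J := by
      intro j
      by_cases hj : j ∈ I
      · exact ⟨0, fun h => absurd hj h⟩
      have : ¬ ∀ p ∈ J, p ∈ supported ℝ ((insert j I : Finset σ) : Set σ) → p = 0 := fun h =>
        hj (hmax (y := insert j I) h (Finset.subset_insert j I) (Finset.mem_insert_self j I))
      push Not at this
      obtain ⟨p, hp, hps, hp0⟩ := this
      rw [Finset.coe_insert] at hps
      obtain ⟨q, hq⟩ := exists_pderiv_notMem hI j hp hp0 hps
      exact ⟨q, fun _ => hq⟩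
    choose f hf using hex
    set g := ∏ j ∈ Iᶜ, pderiv j (f j)
    have hg : g ∉ J := by
      rw [hprime.prod_mem_iff]
      rintro ⟨j, hj, h⟩
      exact (hf j (Finset.mem_compl.1 hj)).2.2 h
    have hcover : {x : σ → ℝ | ∀ p ∈ J, eval x p = 0} ⊆
        {x | (∀ p ∈ J, eval x p = 0) ∧ eval x g ≠ 0} ∪
          {x | (∀ p ∈ J, eval x p = 0) ∧ eval x g = 0} := fun x hx => by
      by_cases h : eval x g = 0
      exacts [Or.inr ⟨hx, h⟩, Or.inl ⟨hx, h⟩]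
    refine (dimH_mono hcover).trans ?_
    rw [dimH_union]
    refine max_le ?_ (ih_sup g hg)
    by_contra! hlt
    obtain ⟨x, hx, hxt⟩ := exists_mem_nhdsWithin_lt_dimH_of_lt_dimH hlt
    obtain ⟨U, hU, hUdim⟩ := exists_mem_nhds_dimH_le
      (S := {x | (∀ p ∈ J, eval x p = 0) ∧ eval x g ≠ 0})
      (fun j hj y hy => hy.1 _ (hf j hj).1) (fun j hj => (hf j hj).2.1) (x := x)
      (fun j hj => by
        have := hx.2
        rw [map_prod, Finset.prod_ne_zero_iff] at this
        exact this j (Finset.mem_compl.2 hj))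
    refine absurd (hxt _ (Filter.inter_mem self_mem_nhdsWithin (mem_nhdsWithin_of_mem_nhds hU))) ?_
    exact not_lt.2 (hUdim.trans (by exact_mod_cast hcard))
  · rw [Ideal.isPrime_iff] at hprime
    push Not at hprime
    obtain ⟨p, q, hpq, hp, hq⟩ := hprime htop
    have hcover : {x : σ → ℝ | ∀ p ∈ J, eval x p = 0} ⊆
        {x | (∀ p ∈ J, eval x p = 0) ∧ eval x p = 0} ∪
          {x | (∀ p ∈ J, eval x p = 0) ∧ eval x q = 0} := fun x hx => by
      have := hx _ hpq
      rw [map_mul, mul_eq_zero] at this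
      exact this.imp (fun h => ⟨hx, h⟩) (fun h => ⟨hx, h⟩)
    refine (dimH_mono hcover).trans ?_
    rw [dimH_union]
    exact max_le (ih_sup p hp) (ih_sup q hq)

/-- A set all of whose projections to `m + 1` coordinates are annihilated by a nonzero polynomial
has dimension at most `m`. -/
lemma dimH_le_of_forall_exists_ne_zero [Fintype σ] {m : ℕ} {S : Set (σ → ℝ)}
    (h : ∀ I : Finset σ, I.card = m + 1 →
      ∃ g : MvPolynomial I ℝ, g ≠ 0 ∧ ∀ x ∈ S, eval (fun i : I => x i) g = 0) :
    dimH S ≤ m := by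
  let J : Ideal (MvPolynomial σ ℝ) := ⨅ x ∈ S, RingHom.ker (eval x)
  have hJ {p : MvPolynomial σ ℝ} : p ∈ J ↔ ∀ x ∈ S, eval x p = 0 := by
    simp [J]
  have hS : S ⊆ {x | ∀ p ∈ J, eval x p = 0} := fun x hx p hp => hJ.1 hp x hx
  refine (dimH_mono hS).trans (dimH_zeroLocus_le J fun I hI => ?_)
  obtain ⟨g, hg0, hg⟩ := h I hI
  refine ⟨rename (↑) g, hJ.2 fun x hx => ?_, ?_, ?_⟩
  · rw [eval_rename]; exact hg x hx
  · exact (map_ne_zero_iff _ (rename_injective _ Subtype.val_injective)).2 hg0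
  · rw [supported_eq_range_rename]; exact ⟨g, rfl⟩

end Dimension

section Projection

open MvPolynomial

variable {a b : ℕ}

/-- The pairs `(η, y)` such that `y` is the tuple of `I`-coordinates of a zero of `P (η, ·)`. -/
def sliceProjection (P : MvPolynomial (Fin a ⊕ Fin b) ℝ) (I : Finset (Fin b)) :
    Set (Fin a ⊕ I → ℝ) :=
  {z | ∃ ξ : Fin b → ℝ, (∀ i : I, ξ i = z (Sum.inr i)) ∧
    eval (Sum.elim (z ∘ Sum.inl) ξ) P = 0}

lemma isSignDefinable_sliceProjection (P : MvPolynomial (Fin a ⊕ Fin b) ℝ) (I : Finset (Fin b)) :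
    IsSignDefinable (sliceProjection P I) := by
  have h : IsSignDefinable {w : (Fin a ⊕ I) ⊕ Fin b → ℝ |
      (∀ i : I, w (Sum.inr i) = w (Sum.inl (Sum.inr i))) ∧
        eval w (rename (Sum.map Sum.inl id) P) = 0} := by
    convert (IsSignDefinable.iInter fun i : I => IsSignDefinable.setOf_eq
      (Sum.inr (i : Fin b) : (Fin a ⊕ I) ⊕ Fin b) (Sum.inl (Sum.inr i))).inter
      (IsSignDefinable.setOf_eval_eq_zero (rename (Sum.map Sum.inl id) P)) using 1
    ext w
    simp
  convert h.exists_sum using 1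
  ext z
  have (ξ : Fin b → ℝ) : Sum.elim z ξ ∘ Sum.map Sum.inl id = Sum.elim (z ∘ Sum.inl) ξ := by
    ext (i | i) <;> rfl
  simp [sliceProjection, eval_rename, this]

/-- The parameters `η` for which some projection of the zero set of `P (η, ·)` to `d` coordinates
has nonempty interior. -/
def fatSliceSet (P : MvPolynomial (Fin a ⊕ Fin b) ℝ) (d : ℕ) : Set (Fin a → ℝ) :=
  {η | ∃ I : Finset (Fin b), I.card = d ∧
    (interior {y : I → ℝ | Sum.elim η y ∈ sliceProjection P I}).Nonempty}

lemma isSignDefinable_fatSliceSet (P : MvPolynomial (Fin a ⊕ Fin b) ℝ) (d : ℕ) :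
    IsSignDefinable (fatSliceSet P d) := by
  convert IsSignDefinable.iUnion fun I : {I : Finset (Fin b) // I.card = d} =>
    (isSignDefinable_sliceProjection P I.1).setOf_nonempty_interior_fiber using 1
  ext η
  rw [Set.mem_iUnion]
  exact ⟨fun ⟨I, hI, h⟩ => ⟨⟨I, hI⟩, h⟩, fun ⟨⟨I, hI⟩, h⟩ => ⟨I, hI, h⟩⟩

lemma le_dimH_of_mem_fatSliceSet {P : MvPolynomial (Fin a ⊕ Fin b) ℝ} {d : ℕ} {η : Fin a → ℝ}
    (h : η ∈ fatSliceSet P d) : (d : ℝ≥0∞) ≤ dimH {ξ | eval (Sum.elim η ξ) P = 0} := by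
  obtain ⟨I, hI, hne⟩ := h
  have hL : LipschitzWith 1 fun (ξ : Fin b → ℝ) (i : I) => ξ i :=
    LipschitzWith.of_dist_le_mul fun ξ ξ' => by
      simpa using (dist_pi_le_iff dist_nonneg).2 fun i : I => dist_le_pi_dist ξ ξ' i
  calc (d : ℝ≥0∞) = dimH {y : I → ℝ | Sum.elim η y ∈ sliceProjection P I} := by
        rw [Real.dimH_of_nonempty_interior hne]
        simp [hI]
    _ ≤ dimH ((fun (ξ : Fin b → ℝ) (i : I) => ξ i) '' {ξ | eval (Sum.elim η ξ) P = 0}) := by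
        refine dimH_mono ?_
        rintro y ⟨ξ, hξ, hP⟩
        exact ⟨ξ, hP, funext hξ⟩
    _ ≤ _ := hL.dimH_image_le _

lemma dimH_le_of_notMem_fatSliceSet {P : MvPolynomial (Fin a ⊕ Fin b) ℝ} {d : ℕ} {η : Fin a → ℝ}
    (h : η ∉ fatSliceSet P (d + 1)) : dimH {ξ | eval (Sum.elim η ξ) P = 0} ≤ d := by
  refine dimH_le_of_forall_exists_ne_zero fun I hI => ?_
  have hfib : IsSignDefinable {y : I → ℝ | Sum.elim η y ∈ sliceProjection P I} := by
    convert (isSignDefinable_sliceProjection P I).preimage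
      (Sum.elim (fun i => C (η i)) X) using 1
    ext y
    have : (fun j => eval y (Sum.elim (fun i => C (η i)) X j)) = Sum.elim η y := by
      ext (i | i) <;> simp
    simp [this]
  obtain ⟨g, hg0, hg⟩ := hfib.exists_ne_zero_of_interior_eq_empty fun hne => h ⟨I, hI, hne⟩
  refine ⟨g, hg0, fun ξ hξ => hg _ ⟨ξ, fun i => rfl, ?_⟩⟩
  simpa [Function.comp_def] using hξ

lemma dimH_slice_eq_iff (P : MvPolynomial (Fin a ⊕ Fin b) ℝ) (m : ℕ) (η : Fin a → ℝ) :
    dimH {ξ : Fin b → ℝ | eval (Sum.elim η ξ) P = 0} = m ↔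
      (m = 0 ∨ η ∈ fatSliceSet P m) ∧ η ∉ fatSliceSet P (m + 1) := by
  constructor
  · intro h
    refine ⟨?_, fun hη => ?_⟩
    · by_contra! hm
      obtain ⟨k, rfl⟩ := Nat.exists_eq_succ_of_ne_zero hm.1
      have := h ▸ dimH_le_of_notMem_fatSliceSet hm.2
      norm_cast at this
      omega
    · have := h ▸ le_dimH_of_mem_fatSliceSet hη
      norm_cast at this
      omega
  · rintro ⟨h, h'⟩
    refine le_antisymm (dimH_le_of_notMem_fatSliceSet h') ?_
    rcases h with rfl | h
    · simp
    · exact le_dimH_of_mem_fatSliceSet h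

end Projection

/-- **Theorem B.4.**  Let `P(η,ξ)` be a real polynomial in the variables
`(η,ξ) ∈ ℝ^a × ℝ^b` and let `m` be an integer.  Then
`{η ∈ ℝ^a : dim_H {ξ ∈ ℝ^b : P(η,ξ) = 0} = m}` is a semi-algebraic subset of `ℝ^a`. -/
theorem slice_dimension_set_is_semialgebraic
    (a b : ℕ) (ha : 1 ≤ a) (hb : 1 ≤ b)
    (P : MvPolynomial (Fin a ⊕ Fin b) ℝ) (m : ℕ) :
    IsSemialgebraic a
      {η : Fin a → ℝ |
        dimH {ξ : Fin b → ℝ | MvPolynomial.eval (Sum.elim η ξ) P = 0} = (m : ℝ≥0∞)} := by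

  refine IsSignDefinable.isSemialgebraic ?_
  simp only [dimH_slice_eq_iff]
  by_cases hm : m = 0
  · convert (isSignDefinable_fatSliceSet P (m + 1)).compl using 1
    ext η
    simp [hm]
  · convert (isSignDefinable_fatSliceSet P m).inter
      (isSignDefinable_fatSliceSet P (m + 1)).compl using 1
    ext η
    simp [hm]

end
end
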